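/- Let p be a prime, n ≥ 1 an integer, k a field of characteristic p, and G = SL_2(p^n) the special linear group of 2×2 matrices of determinant 1 over the field with p^n elements. Then every simple kG-module is algebraic. -/

import Mathlib

open CategoryTheory CategoryTheory.MonoidalCategory

namespace AlgebraicModule

variable {k G : Type} [Field k] [Monoid G]

/-- `N` is a direct summand of `M`, i.e. a retract of `M`. -/
def IsSummand (N M : FDRep k G) : Prop :=
  ∃ (i : N ⟶ M) (r : M ⟶ N), i ≫ r = 𝟙 N

/-- `M` is an indecomposable module: it is nonzero and is not the direct sum of two
nonzero submodules (equivalently, its only idempotent endomorphisms are `0` and `1`). -/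
def Indecomposable (M : FDRep k G) : Prop :=
  ¬ Limits.IsZero M ∧ ∀ e : M ⟶ M, e ≫ e = e → e = 0 ∨ e = 𝟙 M

/-- `tensorPow M n` is the tensor power `M^{⊗ (n + 1)}`, with diagonal `G`-action. -/
noncomputable def tensorPow (M : FDRep k G) : ℕ → FDRep k G
  | 0 => M
  | n + 1 => tensorPow M n ⊗ M

/-- `M` is algebraic: only finitely many isomorphism classes of indecomposable modules
occur as direct summands of the tensor powers `M^{⊗ n}` for `n ≥ 1`. -/
noncomputable def IsAlgebraic (M : FDRep k G) : Prop :=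
  ∃ L : List (FDRep k G), ∀ N : FDRep k G, Indecomposable N →
    (∃ n : ℕ, IsSummand N (tensorPow M n)) → ∃ N' ∈ L, Nonempty (N ≅ N')

end AlgebraicModule

open AlgebraicModule


open CategoryTheory CategoryTheory.MonoidalCategory
open AlgebraicModule

namespace SLAlg
open Representation TensorProduct

/-- bundled finite-dimensional representations -/
structure Rp (K G : Type) [Field K] [Group G] : Type 1 where
  V : Type
  [acg : AddCommGroup V]
  [mod : Module K V]
  [fin : Module.Finite K V]
  ρ : Representation K G V

attribute [instance] Rp.acg Rp.mod Rp.fin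

section basic
variable {K G : Type} [Field K] [Group G]

abbrev Hm (X Y : Rp K G) := X.ρ.IntertwiningMap Y.ρ

noncomputable abbrev Rp.tensor (X Y : Rp K G) : Rp K G := ⟨X.V ⊗[K] Y.V, X.ρ.tprod Y.ρ⟩

noncomputable abbrev Rp.unit (K G : Type) [Field K] [Group G] : Rp K G := ⟨K, Representation.trivial K G K⟩

/-- the endomorphisms of `X` that are sums of maps through members of `S` -/
def thr (X : Rp K G) (S : Set (Rp K G)) : AddSubmonoid (Hm X X) :=
  AddSubmonoid.closure {h | ∃ Y ∈ S, ∃ (f : Hm X Y) (g : Hm Y X), h = g.comp f}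

def InAdd (X : Rp K G) (S : Set (Rp K G)) : Prop :=
  IntertwiningMap.id X.ρ ∈ thr X S

lemma mem_thr {X Y : Rp K G} {S : Set (Rp K G)} (hY : Y ∈ S) (f : Hm X Y) (g : Hm Y X) :
    g.comp f ∈ thr X S := AddSubmonoid.subset_closure ⟨Y, hY, f, g, rfl⟩

lemma thr_comp {X Z : Rp K G} {S : Set (Rp K G)} {h : Hm X X} (hh : h ∈ thr X S)
    (a : Hm Z X) (b : Hm X Z) : b.comp (h.comp a) ∈ thr Z S := by
  induction hh using AddSubmonoid.closure_induction with
  | mem h hh =>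
    obtain ⟨Y, hY, f, g, rfl⟩ := hh
    exact mem_thr hY (f.comp a) (b.comp g)
  | zero =>
    have : b.comp ((0 : Hm X X).comp a) = 0 := by ext v; simp
    rw [this]; exact zero_mem _
  | add x y _ _ hx hy =>
    have : b.comp ((x + y).comp a) = b.comp (x.comp a) + b.comp (y.comp a) := by ext v; simp
    rw [this]; exact add_mem hx hy

lemma InAdd.of_retract {X Y : Rp K G} {S : Set (Rp K G)} (hY : Y ∈ S) (f : Hm X Y) (g : Hm Y X)
    (h : ∀ v, g (f v) = v) : InAdd X S := by
  have : IntertwiningMap.id X.ρ = g.comp f := by ext v; simp [h]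
  rw [InAdd, this]; exact mem_thr hY f g

lemma InAdd.of_mem {X : Rp K G} {S : Set (Rp K G)} (hY : X ∈ S) : InAdd X S :=
  .of_retract hY (IntertwiningMap.id _) (IntertwiningMap.id _) fun _ => rfl

lemma InAdd.of_equiv {X Y : Rp K G} {S : Set (Rp K G)} (hY : Y ∈ S) (e : X.ρ.Equiv Y.ρ) :
    InAdd X S :=
  .of_retract hY e.toIntertwiningMap e.symm.toIntertwiningMap fun v => by simp

lemma InAdd.trans {X : Rp K G} {S T : Set (Rp K G)} (h : InAdd X S) (hS : ∀ Y ∈ S, InAdd Y T) :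
    InAdd X T := by
  have : thr X S ≤ thr X T := by
    refine AddSubmonoid.closure_le.2 ?_
    rintro _ ⟨Y, hY, f, g, rfl⟩
    have := thr_comp (hS Y hY) f g
    have e : g.comp ((IntertwiningMap.id Y.ρ).comp f) = g.comp f := by ext v; simp
    rwa [e] at this
  exact this h

lemma InAdd.mono {X : Rp K G} {S T : Set (Rp K G)} (h : InAdd X S) (hS : S ⊆ T) : InAdd X T :=
  h.trans fun _ hY => .of_mem (hS hY)

lemma thr_tensor {X Z : Rp K G} {S T : Set (Rp K G)} {h : Hm X X} (hh : h ∈ thr X S)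
    {h' : Hm Z Z} (hh' : h' ∈ thr Z T) :
    (h.tensor h' : Hm (X.tensor Z) (X.tensor Z)) ∈
      thr (X.tensor Z) {W | ∃ Y ∈ S, ∃ Y' ∈ T, W = Y.tensor Y'} := by
  induction hh using AddSubmonoid.closure_induction with
  | mem h hh =>
    obtain ⟨Y, hY, f, g, rfl⟩ := hh
    induction hh' using AddSubmonoid.closure_induction with
    | mem h hh =>
      obtain ⟨Y', hY', f', g', rfl⟩ := hh
      have := mem_thr (X := X.tensor Z) (Y := Y.tensor Y')
        (S := {W | ∃ Y ∈ S, ∃ Y' ∈ T, W = Y.tensor Y'}) ⟨Y, hY, Y', hY', rfl⟩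
        (f.tensor f') (g.tensor g')
      convert this using 1
      ext v w; simp
    | zero =>
      have : ((g.comp f).tensor (0 : Hm Z Z) : Hm (X.tensor Z) (X.tensor Z)) = 0 := by ext v w; simp
      rw [this]; exact zero_mem _
    | add x y _ _ hx hy =>
      rw [IntertwiningMap.tensor_add_right]; exact add_mem hx hy
  | zero =>
    have : ((0 : Hm X X).tensor h' : Hm (X.tensor Z) (X.tensor Z)) = 0 := by ext v w; simp
    rw [this]; exact zero_mem _
  | add x y _ _ hx hy =>
    rw [IntertwiningMap.tensor_add_left]; exact add_mem hx hy

lemma InAdd.tensor {X Z : Rp K G} {S T : Set (Rp K G)} (h : InAdd X S) (h' : InAdd Z T) :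
    InAdd (X.tensor Z) {W | ∃ Y ∈ S, ∃ Y' ∈ T, W = Y.tensor Y'} := by
  have := thr_tensor h h'
  have e : IntertwiningMap.id (X.tensor Z).ρ =
      (IntertwiningMap.id X.ρ).tensor (IntertwiningMap.id Z.ρ) := by ext v w; simp
  rw [InAdd, e]; exact this

/-- hit -/
def Hit (X M : Rp K G) : Prop := ∃ f : Hm X M, f ≠ 0

lemma Hit.of_inAdd {X M : Rp K G} {S : Set (Rp K G)} (h : InAdd X S) (hX : Hit X M) :
    ∃ Y ∈ S, Hit Y M := by
  obtain ⟨φ, hφ⟩ := hX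
  by_contra! hc
  have key : ∀ h ∈ thr X S, φ.comp h = 0 := by
    intro h hh
    induction hh using AddSubmonoid.closure_induction with
    | mem h hh =>
      obtain ⟨Y, hY, f, g, rfl⟩ := hh
      have h1 : φ.comp g = 0 := by
        by_contra h2; exact hc Y hY ⟨_, h2⟩
      have : φ.comp (g.comp f) = (φ.comp g).comp f := rfl
      rw [this, h1]; ext v; simp
    | zero => ext v; simp
    | add x y _ _ hx hy =>
      have : φ.comp (x + y) = φ.comp x + φ.comp y := by ext v; simp
      rw [this, hx, hy, add_zero]
  exact hφ (key _ h)

/-! iso classes -/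

instance rpSetoid (K G : Type) [Field K] [Group G] : Setoid (Rp K G) where
  r X Y := Nonempty (X.ρ.Equiv Y.ρ)
  iseqv := ⟨fun _ => ⟨.refl _⟩, fun ⟨e⟩ => ⟨e.symm⟩, fun ⟨e⟩ ⟨f⟩ => ⟨e.trans f⟩⟩

def Cl (K G : Type) [Field K] [Group G] := Quotient (rpSetoid K G)

def cl (X : Rp K G) : Cl K G := Quotient.mk _ X

lemma cl_eq {X Y : Rp K G} : cl X = cl Y ↔ Nonempty (X.ρ.Equiv Y.ρ) := Quotient.eq

noncomputable def tensorEquiv {X X' Y Y' : Rp K G} (e : X.ρ.Equiv X'.ρ) (f : Y.ρ.Equiv Y'.ρ) :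
    (X.tensor Y).ρ.Equiv (X'.tensor Y').ρ :=
  Representation.Equiv.mk (TensorProduct.congr e.toLinearEquiv f.toLinearEquiv) (by
    intro g
    ext v w
    have h1 := IntertwiningMap.isIntertwining _ _ e.toIntertwiningMap g v
    have h2 := IntertwiningMap.isIntertwining _ _ f.toIntertwiningMap g w
    simp at h1 h2 ⊢
    exact congrArg₂ (fun a b => a ⊗ₜ[K] b) h1 h2)

noncomputable instance : CommMonoid (Cl K G) where
  mul := Quotient.map₂ Rp.tensor fun _ _ ⟨e⟩ _ _ ⟨f⟩ => ⟨tensorEquiv e f⟩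
  one := cl (Rp.unit K G)
  mul_assoc := by
    rintro ⟨X⟩ ⟨Y⟩ ⟨Z⟩
    exact cl_eq.2 ⟨Representation.TensorProduct.assoc X.ρ Y.ρ Z.ρ⟩
  one_mul := by
    rintro ⟨X⟩
    exact cl_eq.2 ⟨Representation.TensorProduct.lid K X.ρ⟩
  mul_one := by
    rintro ⟨X⟩
    exact cl_eq.2 ⟨Representation.TensorProduct.rid K X.ρ⟩
  mul_comm := by
    rintro ⟨X⟩ ⟨Y⟩
    exact cl_eq.2 ⟨Representation.TensorProduct.comm X.ρ Y.ρ⟩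

lemma cl_tensor (X Y : Rp K G) : cl (X.tensor Y) = cl X * cl Y := rfl
lemma cl_unit : cl (Rp.unit K G) = 1 := rfl

lemma cl_surj (a : Cl K G) : ∃ X, cl X = a := Quotient.exists_rep a

lemma InAdd.of_cl {X Y : Rp K G} {S : Set (Rp K G)} (h : cl X = cl Y) (hY : InAdd Y S) :
    InAdd X S :=
  InAdd.trans (S := {Y}) (.of_equiv rfl (cl_eq.1 h).some) (by rintro _ rfl; exact hY)

lemma Hit.of_cl {X Y M : Rp K G} (h : cl X = cl Y) (hX : Hit X M) : Hit Y M := by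
  obtain ⟨e⟩ := cl_eq.1 h
  obtain ⟨f, hf⟩ := hX
  refine ⟨f.comp e.symm.toIntertwiningMap, fun h0 => hf ?_⟩
  ext v
  have := congrArg (fun k => k (e v)) h0
  simpa using this

/-- closure operator on classes -/
def CAdd (a : Cl K G) (S : Set (Cl K G)) : Prop :=
  ∀ X, cl X = a → InAdd X {Y | cl Y ∈ S}

lemma CAdd.of_inAdd {X : Rp K G} {S : Set (Cl K G)} (h : InAdd X {Y | cl Y ∈ S}) :
    CAdd (cl X) S := fun _ hY => .of_cl hY h

lemma CAdd.of_mem {a : Cl K G} {S : Set (Cl K G)} (h : a ∈ S) : CAdd a S :=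
  fun X hX => .of_mem (by simpa [hX] using h)

lemma CAdd.trans {a : Cl K G} {S T : Set (Cl K G)} (h : CAdd a S) (hS : ∀ b ∈ S, CAdd b T) :
    CAdd a T := fun X hX => (h X hX).trans fun Y hY => hS _ hY Y rfl

lemma CAdd.mono {a : Cl K G} {S T : Set (Cl K G)} (h : CAdd a S) (hS : S ⊆ T) :
    CAdd a T := h.trans fun _ hb => .of_mem (hS hb)

lemma CAdd.mul {a b : Cl K G} {S T : Set (Cl K G)} (h : CAdd a S) (h' : CAdd b T) :
    CAdd (a * b) {c | ∃ x ∈ S, ∃ y ∈ T, c = x * y} := by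
  obtain ⟨X, rfl⟩ := cl_surj a
  obtain ⟨Y, rfl⟩ := cl_surj b
  rw [← cl_tensor]
  refine .of_inAdd (((h X rfl).tensor (h' Y rfl)).mono ?_)
  rintro _ ⟨Z, hZ, Z', hZ', rfl⟩
  exact ⟨_, hZ, _, hZ', cl_tensor _ _⟩

lemma CAdd.mul_right {a : Cl K G} {S T : Set (Cl K G)} (h : CAdd a S) (b : Cl K G)
    (hT : ∀ x ∈ S, CAdd (x * b) T) : CAdd (a * b) T := by
  refine (h.mul (.of_mem (S := {b}) rfl)).trans ?_
  rintro _ ⟨x, hx, y, rfl, rfl⟩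
  exact hT x hx

/-- A class hits `M`. -/
def CHit (a : Cl K G) (M : Rp K G) : Prop := ∃ X, cl X = a ∧ Hit X M

lemma CHit.of_cadd {a : Cl K G} {M : Rp K G} {S : Set (Cl K G)} (h : CAdd a S) (hX : CHit a M) :
    ∃ b ∈ S, CHit b M := by
  obtain ⟨X, rfl, hX⟩ := hX
  obtain ⟨Y, hY, hh⟩ := hX.of_inAdd (h X rfl)
  exact ⟨_, hY, Y, rfl, hh⟩

end basic
end SLAlg

open CategoryTheory CategoryTheory.MonoidalCategory
open AlgebraicModule

namespace SLAlg
open Representation TensorProduct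

section KS
variable {K G : Type} [Field K] [Group G]

lemma fitting_elem {V : Type} [AddCommGroup V] [Module K V] [Module.Finite K V]
    (f : Module.End K V) : ∃ n : ℕ, ∃ y ∈ Algebra.adjoin K {f}, Commute f y ∧
      ((f * y) ^ (n + 1)) * ((f * y) ^ (n + 1)) = (f * y) ^ (n + 1) ∧
      f ^ (n + 1) * (f * y) ^ (n + 1) = f ^ (n + 1) := by
  let A := Algebra.adjoin K {f}
  let f' : A := ⟨f, Algebra.self_mem_adjoin_singleton K f⟩
  let : CommRing A := Algebra.adjoinCommRingOfComm K (by
    intro a ha b hb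
    rw [Set.mem_singleton_iff] at ha hb
    rw [ha, hb])
  have : IsArtinianRing A := IsArtinianRing.of_finite K A
  obtain ⟨n, y, hy⟩ := IsArtinian.exists_pow_succ_smul_dvd f' (1 : A)
  have hy' : f' ^ (n + 1) * y = f' ^ n := by simpa using hy
  have key : ∀ m, f' ^ (n + 1 + m) * y ^ m = f' ^ (n + 1) := by
    intro m
    induction m with
    | zero => simp
    | succ m ih =>
      calc f' ^ (n + 1 + (m + 1)) * y ^ (m + 1) = (f' ^ (n + 1) * y) * f' ^ (m+1) * y ^ m := by ring
        _ = f' ^ (n + 1 + m) * y ^ m := by rw [hy']; ring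
        _ = _ := ih
  have h1 : f' ^ (n + 1) * (f' * y) ^ (n + 1) = f' ^ (n + 1) := by
    calc _ = f' ^ (n+1) * (f' ^ (n+1) * y ^ (n+1)) := by ring
      _ = f' ^ (n + 1 + (n+1)) * y ^ (n + 1) := by ring
      _ = _ := by rw [key]
  have h2 : ((f' * y) ^ (n + 1)) * ((f' * y) ^ (n + 1)) = (f' * y) ^ (n + 1) := by
    calc _ = (f' ^ (n+1) * (f' * y) ^ (n + 1)) * y ^ (n+1) := by ring
      _ = _ := by rw [h1]; ring
  refine ⟨n, y.1, y.2, ?_, congrArg Subtype.val h2, congrArg Subtype.val h1⟩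
  exact congrArg Subtype.val (mul_comm f' y)

/-- indecomposable -/
def Ind (N : Rp K G) : Prop :=
  Nontrivial N.V ∧ ∀ e : Hm N N, e.comp e = e → e = 0 ∨ e = IntertwiningMap.id N.ρ

lemma adjoin_comm {N : Rp K G} (f : Hm N N) {y : Module.End K N.V}
    (hy : y ∈ Algebra.adjoin K {f.toLinearMap}) (g : G) : Commute y (N.ρ g) := by
  induction hy using Algebra.adjoin_induction with
  | mem x hx =>
    rw [Set.mem_singleton_iff] at hx
    rw [hx]; exact f.isIntertwining' g
  | algebraMap r => exact Algebra.commute_algebraMap_left r _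
  | add x y _ _ hx hy => exact hx.add_left hy
  | mul x y _ _ hx hy => exact hx.mul_left hy

lemma Ind.bij_or_nilp {N : Rp K G} (hN : Ind N) (f : Hm N N) :
    IsUnit f.toLinearMap ∨ IsNilpotent f.toLinearMap := by
  obtain ⟨n, y, hy, hc, h2, h1⟩ := fitting_elem f.toLinearMap
  have hmem : (f.toLinearMap * y) ^ (n + 1) ∈ Algebra.adjoin K {f.toLinearMap} :=
    pow_mem (mul_mem (Algebra.self_mem_adjoin_singleton K _) hy) _
  let e : Hm N N := ⟨(f.toLinearMap * y) ^ (n + 1), fun g => adjoin_comm f hmem g⟩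
  have he : e.comp e = e := by
    apply IntertwiningMap.toLinearMap_injective
    exact h2
  rcases hN.2 e he with h | h
  · right
    have : (f.toLinearMap * y) ^ (n + 1) = 0 := congrArg IntertwiningMap.toLinearMap h
    rw [this, mul_zero] at h1
    exact ⟨_, h1.symm⟩
  · left
    have : (f.toLinearMap * y) ^ (n + 1) = 1 := congrArg IntertwiningMap.toLinearMap h
    have hu : IsUnit ((f.toLinearMap * y) ^ (n + 1)) := by rw [this]; exact isUnit_one
    rw [isUnit_pow_iff (by omega), hc.isUnit_mul_iff] at hu
    exact hu.1

lemma exists_inv {X Y : Rp K G} (f : Hm X Y) (hf : Function.Bijective f) :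
    ∃ g : Hm Y X, (∀ v, g (f v) = v) ∧ ∀ v, f (g v) = v :=
  ⟨(f.ofBijective hf).symm.toIntertwiningMap,
    fun v => (f.ofBijective hf).symm_apply_apply v, fun v => (f.ofBijective hf).apply_symm_apply v⟩

lemma isUnit_iff_bij {V : Type} [AddCommGroup V] [Module K V] (f : Module.End K V) :
    IsUnit f ↔ Function.Bijective f := Module.End.isUnit_iff f

lemma Ind.add {N : Rp K G} (hN : Ind N) (a b : Hm N N) (h : IsUnit (a + b).toLinearMap) :
    IsUnit a.toLinearMap ∨ IsUnit b.toLinearMap := by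
  obtain ⟨u, hu, -⟩ := exists_inv (a + b) ((isUnit_iff_bij _).1 h)
  have hu' : u.toLinearMap * (a.toLinearMap + b.toLinearMap) = 1 := LinearMap.ext hu
  rcases hN.bij_or_nilp (u.comp a) with h1 | h1
  · left
    have h1 : IsUnit (u.toLinearMap * a.toLinearMap) := h1
    exact (IsUnit.mul_iff.1 h1).2
  · right
    have h1 : IsNilpotent (u.toLinearMap * a.toLinearMap) := h1
    have := h1.isUnit_one_sub
    rw [← hu', mul_add, add_sub_cancel_left] at this
    exact (IsUnit.mul_iff.1 this).2

/-- retract -/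
def Retr (N X : Rp K G) : Prop := ∃ (i : Hm N X) (r : Hm X N), ∀ v, r (i v) = v

lemma Ind.retr {N : Rp K G} (hN : Ind N) {S : Set (Rp K G)} (h : InAdd N S) :
    ∃ X ∈ S, Retr N X := by
  by_contra! hc
  have key : ∀ f ∈ thr N S, ¬ IsUnit f.toLinearMap := by
    intro f hf
    induction hf using AddSubmonoid.closure_induction with
    | mem f hf =>
      obtain ⟨Y, hY, f, g, rfl⟩ := hf
      intro hu
      obtain ⟨u, hu, -⟩ := exists_inv (g.comp f) ((isUnit_iff_bij _).1 hu)
      exact hc Y hY ⟨f, u.comp g, hu⟩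
    | zero =>
      have := hN.1
      exact not_isUnit_zero
    | add x y _ _ hx hy =>
      intro hu
      rcases hN.add x y hu with h | h
      exacts [hx h, hy h]
  exact key _ h isUnit_one

lemma Ind.equiv_of_retr {N X : Rp K G} (hN : Ind N) (hX : Ind X) (h : Retr N X) :
    Nonempty (N.ρ.Equiv X.ρ) := by
  obtain ⟨i, r, h⟩ := h
  rcases hX.2 (i.comp r) (by ext v; simp [h]) with h1 | h1
  · exfalso
    have := hN.1
    obtain ⟨v, hv⟩ := exists_ne (0 : N.V)
    have := congrArg (fun f => r (f (i v))) h1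
    simp [h] at this
    exact hv this
  · refine ⟨i.ofBijective ⟨fun a b hab => by rw [← h a, hab, h], fun v => ⟨r v, ?_⟩⟩⟩
    exact congrArg (fun f => f v) h1

/-- sub rep -/
noncomputable abbrev Rp.sub (X : Rp K G) (W : Subrepresentation X.ρ) : Rp K G :=
  ⟨W.toSubmodule, W.toRepresentation⟩

def subIncl (X : Rp K G) (W : Subrepresentation X.ρ) : Hm (X.sub W) X :=
  ⟨W.toSubmodule.subtype, fun g => by ext v; rfl⟩

def subCod {X Y : Rp K G} (W : Subrepresentation X.ρ) (f : Hm Y X) (h : ∀ v, f v ∈ W.toSubmodule) :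
    Hm Y (X.sub W) :=
  ⟨f.toLinearMap.codRestrict W.toSubmodule h, fun g => by
    ext v
    exact IntertwiningMap.isIntertwining _ _ f g v⟩

lemma idem_lt {X : Rp K G} (e : Hm X X) (he : e.comp e = e) (h1 : e ≠ IntertwiningMap.id X.ρ) :
    Module.finrank K (X.sub e.range).V < Module.finrank K X.V := by
  apply Submodule.finrank_lt
  intro h
  apply h1
  ext v
  have : v ∈ LinearMap.range e.toLinearMap := by
    have h' : LinearMap.range e.toLinearMap = ⊤ := h
    rw [h']; trivial
  obtain ⟨w, hw⟩ := this
  have := congrArg (fun f => f w) he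
  change e w = v at hw
  simp [hw] at this
  simpa using this

lemma exists_ind_list (n : ℕ) : ∀ X : Rp K G, Module.finrank K X.V = n →
    ∃ L : List (Rp K G), (∀ Y ∈ L, Ind Y) ∧ InAdd X {Y | Y ∈ L} := by
  induction n using Nat.strong_induction_on with
  | _ n ih =>
  intro X hX
  by_cases h0 : Nontrivial X.V
  · by_cases hI : Ind X
    · exact ⟨[X], by simpa using hI, .of_mem (by simp)⟩
    · rw [Ind, not_and] at hI
      have := hI h0
      push Not at this
      obtain ⟨e, he, hz, hone⟩ := this
      let e' : Hm X X := IntertwiningMap.id X.ρ - e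
      have hee : ∀ v, e (e v) = e v := fun v => congrArg (fun f => f v) he
      have he' : e'.comp e' = e' := by
        ext v; simp [e', hee]
      have hone' : e' ≠ IntertwiningMap.id X.ρ := by
        intro h; apply hz
        ext v
        have := congrArg (fun f => f v) h
        simpa [e'] using this
      obtain ⟨L1, hL1, h1⟩ := ih _ (hX ▸ idem_lt e he hone) _ rfl
      obtain ⟨L2, hL2, h2⟩ := ih _ (hX ▸ idem_lt e' he' hone') _ rfl
      refine ⟨L1 ++ L2, ?_, ?_⟩
      · intro Y hY
        rcases List.mem_append.1 hY with h | h
        exacts [hL1 Y h, hL2 Y h]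
      · have hid : InAdd X {X.sub e.range, X.sub e'.range} := by
          have : IntertwiningMap.id X.ρ =
              (subIncl X e.range).comp (subCod e.range e fun v => ⟨v, rfl⟩) +
              (subIncl X e'.range).comp (subCod e'.range e' fun v => ⟨v, rfl⟩) := by
            ext v
            change v = e v + (v - e v)
            simp
          rw [InAdd, this]
          exact add_mem (mem_thr (by simp) _ _) (mem_thr (by simp) _ _)
        refine hid.trans ?_
        rintro Y (rfl | rfl)
        · exact h1.mono fun Y hY => List.mem_append.2 (.inl hY)
        · exact h2.mono fun Y hY => List.mem_append.2 (.inr hY)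
  · refine ⟨[], by simp, ?_⟩
    have : IntertwiningMap.id X.ρ = 0 := by
      rw [not_nontrivial_iff_subsingleton] at h0
      ext v; exact Subsingleton.elim _ _
    rw [InAdd, this]; exact zero_mem _

theorem ks_finite (T : Set (Rp K G)) (hT : T.Finite) :
    ∃ L : List (Rp K G), ∀ N : Rp K G, Ind N → (∃ X, InAdd X T ∧ Retr N X) →
      ∃ N' ∈ L, Nonempty (N.ρ.Equiv N'.ρ) := by
  choose L hL hL' using fun X : Rp K G => exists_ind_list _ X rfl
  refine ⟨hT.toFinset.toList.flatMap L, ?_⟩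
  rintro N hN ⟨X, hX, i, r, hir⟩
  have h1 : InAdd N T :=
    InAdd.trans (S := {X}) (.of_retract rfl i r hir) (by rintro _ rfl; exact hX)
  obtain ⟨Y, hY, i, r, hir⟩ := hN.retr h1
  have h2 : InAdd N {Z | Z ∈ L Y} :=
    InAdd.trans (S := {Y}) (.of_retract rfl i r hir) (by rintro _ rfl; exact hL' _)
  obtain ⟨Z, hZ, hr⟩ := hN.retr h2
  exact ⟨Z, by simp; exact ⟨Y, hY, hZ⟩, hN.equiv_of_retr (hL Y Z hZ) hr⟩

end KS
end SLAlg

open CategoryTheory CategoryTheory.MonoidalCategory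
open AlgebraicModule

namespace SLAlg
open Representation TensorProduct

section poly
variable {K G : Type} [Field K] [Group G]

abbrev P2 (K : Type) [Field K] := MvPolynomial (Fin 2) K

noncomputable def mon (i j : ℕ) : Fin 2 →₀ ℕ := Finsupp.single 0 i + Finsupp.single 1 j

@[simp] lemma mon_zero (i j : ℕ) : mon i j 0 = i := by simp [mon]
@[simp] lemma mon_one (i j : ℕ) : mon i j 1 = j := by simp [mon]
lemma mon_self (d : Fin 2 →₀ ℕ) : mon (d 0) (d 1) = d := by
  ext i; fin_cases i <;> simp
lemma exists_mon (d : Fin 2 →₀ ℕ) : ∃ i j, d = mon i j := ⟨_, _, (mon_self d).symm⟩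
@[simp] lemma mon_inj {i j i' j' : ℕ} : mon i j = mon i' j' ↔ i = i' ∧ j = j' := by
  constructor
  · intro h
    exact ⟨by simpa using congrArg (fun d => d 0) h, by simpa using congrArg (fun d => d 1) h⟩
  · rintro ⟨rfl, rfl⟩; rfl
@[simp] lemma mon_degree (i j : ℕ) : (mon i j).degree = i + j := by
  simp [mon, Finsupp.degree_eq_sum]
lemma mon_add_zero (i j k : ℕ) : mon i j + Finsupp.single 0 k = mon (i + k) j := by
  ext l; fin_cases l <;> simp
lemma mon_add_one (i j k : ℕ) : mon i j + Finsupp.single 1 k = mon i (j + k) := by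
  ext l; fin_cases l <;> simp

/-- coefficient -/
noncomputable def cf (i j : ℕ) : P2 K →ₗ[K] K := MvPolynomial.lcoeff K (mon i j)

lemma cf_apply (i j : ℕ) (f : P2 K) : cf i j f = f.coeff (mon i j) := rfl

lemma ext_cf {f g : P2 K} (h : ∀ i j, cf i j f = cf i j g) : f = g := by
  ext d
  obtain ⟨i, j, rfl⟩ := exists_mon d
  exact h i j

open MvPolynomial in
lemma cf_X0_mul (i j : ℕ) (f : P2 K) : cf (i + 1) j (X 0 * f) = cf i j f := by
  rw [cf_apply, cf_apply, mul_comm, ← mon_add_zero, coeff_mul_X]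
open MvPolynomial in
lemma cf_X1_mul (i j : ℕ) (f : P2 K) : cf i (j + 1) (X 1 * f) = cf i j f := by
  rw [cf_apply, cf_apply, mul_comm, ← mon_add_one, coeff_mul_X]
open MvPolynomial in
lemma cf_X0_mul_zero (j : ℕ) (f : P2 K) : cf 0 j (X 0 * f) = 0 := by
  rw [cf_apply, mul_comm, coeff_mul_X', if_neg]
  simp
open MvPolynomial in
lemma cf_X1_mul_zero (i : ℕ) (f : P2 K) : cf i 0 (X 1 * f) = 0 := by
  rw [cf_apply, mul_comm, coeff_mul_X', if_neg]
  simp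
open MvPolynomial in
lemma cf_D0 (i j : ℕ) (f : P2 K) : cf i j (pderiv 0 f) = (i + 1) * cf (i + 1) j f := by
  rw [cf_apply, cf_apply, coeff_pderiv, mon_add_zero, mon_zero, mul_comm]
open MvPolynomial in
lemma cf_D1 (i j : ℕ) (f : P2 K) : cf i j (pderiv 1 f) = (j + 1) * cf i (j + 1) f := by
  rw [cf_apply, cf_apply, coeff_pderiv, mon_add_one, mon_one, mul_comm]

/-- homogeneous polynomials -/
abbrev Hg (K : Type) [Field K] (a : ℕ) : Submodule K (P2 K) :=
  MvPolynomial.homogeneousSubmodule (Fin 2) K a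

lemma hg_cf {a : ℕ} {f : P2 K} (hf : f ∈ Hg K a) {i j : ℕ} (h : i + j ≠ a) : cf i j f = 0 :=
  MvPolynomial.IsHomogeneous.coeff_eq_zero hf (by simpa using h)

lemma hg_of_cf {a : ℕ} {f : P2 K} (h : ∀ i j, i + j ≠ a → cf i j f = 0) : f ∈ Hg K a := by
  intro d hd
  obtain ⟨i, j, rfl⟩ := exists_mon d
  have : (mon i j).degree = a := by
    by_contra hne
    exact hd (h i j (by simpa using hne))
  rw [Finsupp.degree_eq_weight_one] at this
  exact this

open MvPolynomial in
lemma cf_monomial (i j i' j' : ℕ) (c : K) :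
    cf i j (monomial (mon i' j') c) = if i = i' ∧ j = j' then c else 0 := by
  rw [cf_apply, coeff_monomial]
  simp [eq_comm]

open MvPolynomial in
lemma hg_monomial (i j : ℕ) (c : K) : monomial (mon i j) c ∈ Hg K (i + j) := by
  apply hg_of_cf
  intro i' j' h
  rw [cf_monomial, if_neg]
  rintro ⟨rfl, rfl⟩; exact h rfl

/-- coordinates -/
noncomputable def hgEquiv (K : Type) [Field K] (a : ℕ) : Hg K a ≃ₗ[K] (Fin (a + 1) → K) where
  toFun f i := cf i (a - i) f.1
  map_add' f g := by ext i; simp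
  map_smul' c f := by ext i; simp
  invFun v := ⟨∑ i : Fin (a + 1), MvPolynomial.monomial (mon i (a - i)) (v i), by
    refine Submodule.sum_mem _ fun i _ => ?_
    have := hg_monomial (i : ℕ) (a - i) (v i)
    rwa [Nat.add_sub_cancel' (by omega)] at this⟩
  left_inv f := by
    apply Subtype.ext
    apply ext_cf
    intro i j
    by_cases h : i + j = a
    · subst h
      simp only [map_sum, cf_monomial]
      rw [Finset.sum_eq_single (⟨i, by omega⟩ : Fin (i + j + 1))]
      · simp
      · rintro b - hb
        rw [if_neg]
        rintro ⟨h1, -⟩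
        exact hb (Fin.ext h1.symm)
      · simp
    · rw [hg_cf f.2 h]
      simp only [map_sum, cf_monomial]
      apply Finset.sum_eq_zero
      intro b _
      rw [if_neg]
      rintro ⟨h1, h2⟩
      omega
  right_inv v := by
    ext i
    simp only [map_sum, cf_monomial]
    rw [Finset.sum_eq_single i]
    · simp
    · rintro b - hb
      rw [if_neg]
      rintro ⟨h1, -⟩
      exact hb (Fin.ext h1.symm)
    · simp

instance (a : ℕ) : Module.Finite K (Hg K a) := Module.Finite.equiv (hgEquiv K a).symm

lemma finrank_hg (a : ℕ) : Module.finrank K (Hg K a) = a + 1 := by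
  rw [(hgEquiv K a).finrank_eq]; simp

open MvPolynomial in
lemma X_mem {a : ℕ} (i : Fin 2) {f : P2 K} (hf : f ∈ Hg K a) : X i * f ∈ Hg K (a + 1) := by
  rw [add_comm]; exact (isHomogeneous_X K i).mul hf

open MvPolynomial in
lemma D_mem {a : ℕ} (i : Fin 2) {f : P2 K} (hf : f ∈ Hg K (a + 1)) : pderiv i f ∈ Hg K a := by
  apply hg_of_cf
  intro k l h
  fin_cases i
  · change cf k l (pderiv 0 f) = 0
    rw [cf_D0, hg_cf hf (by omega), mul_zero]
  · change cf k l (pderiv 1 f) = 0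
    rw [cf_D1, hg_cf hf (by omega), mul_zero]

noncomputable def mX (i : Fin 2) (a : ℕ) : Hg K a →ₗ[K] Hg K (a + 1) :=
  (LinearMap.mulLeft K (MvPolynomial.X i)).restrict fun _ h => X_mem i h

noncomputable def mD (i : Fin 2) (a : ℕ) : Hg K (a + 1) →ₗ[K] Hg K a :=
  (MvPolynomial.pderiv i).toLinearMap.restrict fun _ h => D_mem i h

lemma mX_val (i : Fin 2) (a : ℕ) (f : Hg K a) : (mX i a f).1 = MvPolynomial.X i * f.1 := rfl
lemma mD_val (i : Fin 2) (a : ℕ) (f : Hg K (a+1)) : (mD i a f).1 = MvPolynomial.pderiv i f.1 := rfl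

lemma euler {a : ℕ} {f : P2 K} (hf : f ∈ Hg K a) :
    MvPolynomial.X 0 * MvPolynomial.pderiv 0 f + MvPolynomial.X 1 * MvPolynomial.pderiv 1 f
      = (a : K) • f := by
  have := MvPolynomial.IsHomogeneous.sum_X_mul_pderiv hf
  rw [Fin.sum_univ_two] at this
  rw [this, ← Nat.cast_smul_eq_nsmul K]

/-! the action -/

abbrev SL2 (K : Type) [Field K] := Matrix.SpecialLinearGroup (Fin 2) K

noncomputable def sub (A : Matrix (Fin 2) (Fin 2) K) : P2 K →ₐ[K] P2 K :=
  MvPolynomial.aeval fun j => A 0 j • MvPolynomial.X 0 + A 1 j • MvPolynomial.X 1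

lemma sub_X (A : Matrix (Fin 2) (Fin 2) K) (j : Fin 2) :
    sub A (MvPolynomial.X j) = A 0 j • MvPolynomial.X 0 + A 1 j • MvPolynomial.X 1 := by
  simp [sub]

lemma sub_one : sub (1 : Matrix (Fin 2) (Fin 2) K) = AlgHom.id K _ := by
  apply MvPolynomial.algHom_ext
  intro j
  rw [sub_X]
  fin_cases j
  · simp [Matrix.one_apply]
  · simp [Matrix.one_apply]

lemma sub_mul (A B : Matrix (Fin 2) (Fin 2) K) : sub (A * B) = (sub A).comp (sub B) := by
  apply MvPolynomial.algHom_ext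
  intro j
  rw [sub_X, AlgHom.comp_apply, sub_X, map_add, map_smul, map_smul, sub_X, sub_X,
    Matrix.mul_apply, Matrix.mul_apply, Fin.sum_univ_two, Fin.sum_univ_two]
  module

lemma sub_mem (A : Matrix (Fin 2) (Fin 2) K) {a : ℕ} {f : P2 K} (hf : f ∈ Hg K a) :
    sub A f ∈ Hg K a := by
  have := MvPolynomial.IsHomogeneous.aeval (S := K) hf
    (fun j => A 0 j • MvPolynomial.X 0 + A 1 j • MvPolynomial.X 1 : Fin 2 → P2 K) (n := 1) (by
      intro j
      refine MvPolynomial.IsHomogeneous.add ?_ ?_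
      · exact (Hg K 1).smul_mem _ (MvPolynomial.isHomogeneous_X K _)
      · exact (Hg K 1).smul_mem _ (MvPolynomial.isHomogeneous_X K _))
  rw [one_mul] at this
  exact this

open MvPolynomial in
lemma D_sub (A : Matrix (Fin 2) (Fin 2) K) (i : Fin 2) (f : P2 K) :
    pderiv i (sub A f) = A i 0 • sub A (pderiv 0 f) + A i 1 • sub A (pderiv 1 f) := by
  induction f using MvPolynomial.induction_on with
  | C c => simp [sub]
  | add f g hf hg => simp only [map_add, hf, hg]; module
  | mul_X f j hf =>
    simp only [map_mul, Derivation.leibniz, hf, sub_X, map_add, Derivation.map_smul]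
    fin_cases j <;> fin_cases i <;>
      simp [pderiv_X, sub_X, Algebra.smul_def] <;> ring

noncomputable def syA (A : SL2 K) (a : ℕ) : Hg K a →ₗ[K] Hg K a :=
  (sub A.1).toLinearMap.restrict fun _ h => sub_mem _ h

lemma syA_val (A : SL2 K) (a : ℕ) (f : Hg K a) : (syA A a f).1 = sub A.1 f.1 := rfl

noncomputable def syRep (γ : G →* SL2 K) (a : ℕ) : Representation K G (Hg K a) where
  toFun := fun g => syA (γ g) a
  map_one' := by
    ext1 f; apply Subtype.ext
    rw [syA_val]
    simp [sub_one]
  map_mul' := fun g h => by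
    ext1 f; apply Subtype.ext
    rw [syA_val, map_mul, Matrix.SpecialLinearGroup.coe_mul, sub_mul]; rfl

lemma syRep_apply (γ : G →* SL2 K) (a : ℕ) (g : G) : syRep γ a g = syA (γ g) a := rfl

/-- symmetric power -/
noncomputable abbrev Sy (γ : G →* SL2 K) (a : ℕ) : Rp K G := ⟨Hg K a, syRep γ a⟩

noncomputable def twoRep (γ : G →* SL2 K) {M : Type} [AddCommGroup M] [Module K M]
    (ρ : Representation K G M) : Representation K G (M × M) where
  toFun := fun g => LinearMap.prod
        ((γ g).1 0 0 • (ρ g ∘ₗ LinearMap.fst K _ _) + (γ g).1 0 1 • (ρ g ∘ₗ LinearMap.snd K _ _))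
        ((γ g).1 1 0 • (ρ g ∘ₗ LinearMap.fst K _ _) + (γ g).1 1 1 • (ρ g ∘ₗ LinearMap.snd K _ _))
  map_one' := by
    apply LinearMap.ext; rintro ⟨a, b⟩
    simp
  map_mul' := fun g h => by
    apply LinearMap.ext; rintro ⟨a, b⟩
    simp only [map_mul, Matrix.SpecialLinearGroup.coe_mul, Matrix.mul_apply, Fin.sum_univ_two]
    ext
    · simp; module
    · simp; module

/-- pairs: `V ⊗ X` -/
noncomputable abbrev two (γ : G →* SL2 K) (X : Rp K G) : Rp K G := ⟨X.V × X.V, twoRep γ X.ρ⟩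

noncomputable abbrev Vr (γ : G →* SL2 K) : Rp K G := two γ (Rp.unit K G)

lemma two_ρ (γ : G →* SL2 K) {M : Type} [AddCommGroup M] [Module K M]
    (ρ : Representation K G M) (g : G) (a b : M) :
    twoRep γ ρ g (a, b) = ((γ g).1 0 0 • ρ g a + (γ g).1 0 1 • ρ g b,
      (γ g).1 1 0 • ρ g a + (γ g).1 1 1 • ρ g b) := rfl

noncomputable def twoLin (M : Type) [AddCommGroup M] [Module K M] :
    (K × K) ⊗[K] M ≃ₗ[K] M × M :=
  LinearEquiv.ofLinearMap
    (TensorProduct.lift (LinearMap.mk₂ K (fun (v : K × K) (f : M) => ((v.1 • f, v.2 • f) : M × M))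
      (by intros; ext <;> simp [add_smul]) (by intros; ext <;> simp [mul_smul])
      (by intros; ext <;> simp) (by intros; ext <;> exact smul_comm _ _ _)))
    (LinearMap.coprod (TensorProduct.mk K (K × K) M (1, 0)) (TensorProduct.mk K (K × K) M (0, 1)))
    (by
      apply LinearMap.ext; rintro ⟨a, b⟩
      rw [LinearMap.comp_apply, LinearMap.coprod_apply, map_add]
      simp)
    (by
      apply TensorProduct.ext'; rintro ⟨v, w⟩ f
      rw [LinearMap.comp_apply, TensorProduct.lift.tmul, LinearMap.mk₂_apply,
        LinearMap.coprod_apply, TensorProduct.mk_apply, TensorProduct.mk_apply,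
        ← TensorProduct.smul_tmul, ← TensorProduct.smul_tmul, ← TensorProduct.add_tmul]
      simp)

lemma twoLin_tmul (M : Type) [AddCommGroup M] [Module K M] (v : K × K) (f : M) :
    twoLin M (v ⊗ₜ[K] f) = (v.1 • f, v.2 • f) := by simp [twoLin]

noncomputable def twoEquiv (γ : G →* SL2 K) (X : Rp K G) :
    ((Vr γ).tensor X).ρ.Equiv (two γ X).ρ :=
  .mk (twoLin X.V) (by
    intro g
    apply TensorProduct.ext'; rintro ⟨v, w⟩ f
    simp only [LinearMap.comp_apply, Representation.tprod_apply, TensorProduct.map_tmul,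
      LinearEquiv.coe_coe, twoLin_tmul, two_ρ]
    simp [add_smul, mul_smul])

lemma cl_two (γ : G →* SL2 K) (X : Rp K G) : cl (two γ X) = cl (Vr γ) * cl X := by
  have h : cl ((Vr γ).tensor X) = cl (two γ X) :=
    (cl_eq (X := (Vr γ).tensor X) (Y := two γ X)).2 ⟨twoEquiv γ X⟩
  have h2 : cl ((Vr γ).tensor X) = cl (Vr γ) * cl X := cl_tensor (Vr γ) X
  rw [← h, h2]

lemma sy_X (A : SL2 K) (a : ℕ) (i : Fin 2) (f : Hg K a) :
    syA A (a + 1) (mX i a f) =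
      A.1 0 i • mX 0 a (syA A a f) + A.1 1 i • mX 1 a (syA A a f) := by
  apply Subtype.ext
  simp only [syA_val, mX_val, Submodule.coe_add, Submodule.coe_smul, map_mul, sub_X]
  simp only [Algebra.smul_def]; ring

lemma sy_D (A : SL2 K) (a : ℕ) (i : Fin 2) (f : Hg K (a + 1)) :
    mD i a (syA A (a + 1) f) =
      A.1 i 0 • syA A a (mD 0 a f) + A.1 i 1 • syA A a (mD 1 a f) := by
  apply Subtype.ext
  exact D_sub A.1 i f.1

lemma det_eq (A : SL2 K) : A.1 0 0 * A.1 1 1 - A.1 0 1 * A.1 1 0 = 1 := by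
  have := A.2
  rwa [Matrix.det_fin_two] at this

end poly
end SLAlg

open CategoryTheory CategoryTheory.MonoidalCategory
open AlgebraicModule

namespace SLAlg
open Representation TensorProduct

section maps
variable {K G : Type} [Field K] [Group G]

noncomputable def multL (K : Type) [Field K] (a : ℕ) : Hg K a × Hg K a →ₗ[K] Hg K (a + 1) :=
  LinearMap.coprod (mX 0 a) (mX 1 a)
noncomputable def omL (K : Type) [Field K] (a : ℕ) : Hg K (a + 1) × Hg K (a + 1) →ₗ[K] Hg K a :=
  LinearMap.coprod (mD 1 a) (-mD 0 a)
noncomputable def polL (K : Type) [Field K] (a : ℕ) : Hg K (a + 1) →ₗ[K] Hg K a × Hg K a :=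
  LinearMap.prod (mD 0 a) (mD 1 a)
noncomputable def kaL (K : Type) [Field K] (a : ℕ) : Hg K a →ₗ[K] Hg K (a + 1) × Hg K (a + 1) :=
  LinearMap.prod (mX 1 a) (-mX 0 a)

lemma multL_apply (a : ℕ) (f g : Hg K a) : multL K a (f, g) = mX 0 a f + mX 1 a g := rfl
lemma omL_apply (a : ℕ) (f g : Hg K (a+1)) : omL K a (f, g) = mD 1 a f - mD 0 a g := by
  simp [omL, sub_eq_add_neg]
lemma polL_apply (a : ℕ) (f : Hg K (a+1)) : polL K a f = (mD 0 a f, mD 1 a f) := rfl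
lemma kaL_apply (a : ℕ) (f : Hg K a) : kaL K a f = (mX 1 a f, -mX 0 a f) := rfl

noncomputable def multT (γ : G →* SL2 K) (a : ℕ) : Hm (two γ (Sy γ a)) (Sy γ (a + 1)) :=
  ⟨multL K a, fun g => by
    apply LinearMap.ext; rintro ⟨f, h⟩
    simp only [LinearMap.comp_apply, two_ρ, multL_apply, map_add, syRep_apply, sy_X, map_smul]
    module⟩

noncomputable def omT (γ : G →* SL2 K) (a : ℕ) : Hm (two γ (Sy γ (a+1))) (Sy γ a) :=
  ⟨omL K a, fun g => by
    apply LinearMap.ext; rintro ⟨f, h⟩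
    simp only [LinearMap.comp_apply, two_ρ, omL_apply, map_add, map_sub, syRep_apply, sy_D, map_smul]
    have hd := det_eq (γ g)
    linear_combination (norm := module) hd • (syA (γ g) a (mD 1 a f)) - hd • (syA (γ g) a (mD 0 a h))⟩

noncomputable def polT (γ : G →* SL2 K) (a : ℕ) : Hm (Sy γ (a + 1)) (two γ (Sy γ a)) :=
  ⟨polL K a, fun g => by
    apply LinearMap.ext; intro f
    simp only [LinearMap.comp_apply, two_ρ, polL_apply, syRep_apply, sy_D]⟩

noncomputable def kaT (γ : G →* SL2 K) (a : ℕ) : Hm (Sy γ a) (two γ (Sy γ (a+1))) :=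
  ⟨kaL K a, fun g => by
    apply LinearMap.ext; intro f
    have hd := det_eq (γ g)
    simp only [LinearMap.comp_apply, two_ρ, kaL_apply, syRep_apply, sy_X, map_neg]
    refine Prod.ext ?_ ?_
    · linear_combination (norm := module) -hd • (mX 1 a (syA (γ g) a f))
    · linear_combination (norm := module) hd • (mX 0 a (syA (γ g) a f))⟩

open MvPolynomial in
lemma pol_mult (a : ℕ) (w : Hg K (a+1) × Hg K (a+1)) :
    polL K (a+1) (multL K (a+1) w) + kaL K a (omL K a w) = ((a : K) + 2) • w := by
  obtain ⟨f, h⟩ := w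
  rw [multL_apply, omL_apply, polL_apply, kaL_apply]
  have ef := euler f.2
  have eh := euler h.2
  refine Prod.ext ?_ ?_
  · apply Subtype.ext
    simp only [Prod.mk_add_mk, Submodule.coe_add, mD_val, mX_val, Prod.smul_mk, Submodule.coe_smul,
      map_add, map_sub, Submodule.coe_sub, Derivation.leibniz, pderiv_X]
    simp [Algebra.smul_def] at ef ⊢
    have h2 : (C 2 : P2 K) = 2 := map_ofNat C 2
    rw [h2]; linear_combination ef
  · apply Subtype.ext
    simp only [Prod.mk_add_mk, Submodule.coe_add, mD_val, mX_val, Prod.smul_mk, Submodule.coe_smul,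
      map_add, map_sub, Submodule.coe_sub, Submodule.coe_neg, Derivation.leibniz, pderiv_X]
    simp [Algebra.smul_def] at eh ⊢
    have h2 : (C 2 : P2 K) = 2 := map_ofNat C 2
    rw [h2]; linear_combination eh

open MvPolynomial in
lemma mult_pol (a : ℕ) (f : Hg K (a+1)) :
    multL K a (polL K a f) = ((a : K) + 1) • f := by
  rw [polL_apply, multL_apply]
  apply Subtype.ext
  have := euler f.2
  simpa [mX_val, mD_val] using this

open MvPolynomial in
lemma pol_mult_zero (w : Hg K 0 × Hg K 0) : polL K 0 (multL K 0 w) = w := by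
  obtain ⟨f, h⟩ := w
  rw [multL_apply, polL_apply]
  have hf : ∀ i, ∀ f : Hg K 0, pderiv i f.1 = 0 := by
    intro i f
    have := f.2
    rw [mem_homogeneousSubmodule, ← totalDegree_zero_iff_isHomogeneous, totalDegree_eq_zero_iff_eq_C] at this
    rw [this, pderiv_C]
  refine Prod.ext ?_ ?_
  · apply Subtype.ext
    simp [mD_val, mX_val, hf, pderiv_X]
  · apply Subtype.ext
    simp [mD_val, mX_val, hf, pderiv_X]

variable (γ : G →* SL2 K)

lemma T1_zero : CAdd (cl (Vr γ) * cl (Sy γ 0)) {cl (Sy γ 1)} := by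
  rw [← cl_two]
  exact .of_inAdd (.of_retract (Y := Sy γ 1) rfl (multT γ 0) (polT γ 0) pol_mult_zero)

lemma T1_succ (a : ℕ) (ha : (a : K) + 2 ≠ 0) :
    CAdd (cl (Vr γ) * cl (Sy γ (a + 1))) {cl (Sy γ (a + 2)), cl (Sy γ a)} := by
  rw [← cl_two]
  apply CAdd.of_inAdd
  have e : IntertwiningMap.id (two γ (Sy γ (a+1))).ρ =
      (((a : K) + 2)⁻¹ • polT γ (a+1)).comp (multT γ (a+1)) +
      (((a : K) + 2)⁻¹ • kaT γ a).comp (omT γ a) := by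
    apply IntertwiningMap.toLinearMap_injective
    apply LinearMap.ext
    intro w
    have := pol_mult a w
    change w = ((a : K) + 2)⁻¹ • polL K (a+1) (multL K (a+1) w) + ((a : K) + 2)⁻¹ • kaL K a (omL K a w)
    rw [← smul_add, this, inv_smul_smul₀ ha]
  rw [InAdd, e]
  exact add_mem (mem_thr (Y := Sy γ (a+2)) (by simp) _ _) (mem_thr (Y := Sy γ a) (by simp) _ _)

lemma T1_ret (a : ℕ) (ha : (a : K) + 1 ≠ 0) :
    CAdd (cl (Sy γ (a + 1))) {cl (Vr γ) * cl (Sy γ a)} := by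
  apply CAdd.of_inAdd
  refine .of_retract (Y := two γ (Sy γ a)) (cl_two γ _)
    (polT γ a) (((a : K) + 1)⁻¹ • multT γ a) ?_
  intro v
  change ((a : K) + 1)⁻¹ • multL K a (polL K a v) = v
  rw [mult_pol, inv_smul_smul₀ ha]

open MvPolynomial in
noncomputable def sy0Lin (K : Type) [Field K] : K ≃ₗ[K] Hg K 0 where
  toFun c := ⟨C c, isHomogeneous_C _ c⟩
  map_add' a b := by apply Subtype.ext; simp
  map_smul' a b := by apply Subtype.ext; simp [Algebra.smul_def]
  invFun f := coeff 0 f.1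
  left_inv c := by simp
  right_inv f := by
    apply Subtype.ext
    have := f.2
    rw [mem_homogeneousSubmodule, ← totalDegree_zero_iff_isHomogeneous, totalDegree_eq_zero_iff_eq_C] at this
    exact this.symm

lemma cl_sy0 : cl (Sy γ 0) = 1 := by
  rw [← cl_unit]
  have e : (Rp.unit K G).ρ.Equiv (Sy γ 0).ρ := .mk (sy0Lin K) (by
    intro g
    apply LinearMap.ext
    intro c
    apply Subtype.ext
    change MvPolynomial.C _ = sub (γ g).1 (MvPolynomial.C c)
    simp [sub])
  exact ((cl_eq (X := Rp.unit K G) (Y := Sy γ 0)).2 ⟨e⟩).symm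

end maps
end SLAlg

open CategoryTheory CategoryTheory.MonoidalCategory
open AlgebraicModule

namespace SLAlg
open Representation TensorProduct

section E21
variable {K : Type} [Field K]
open MvPolynomial

noncomputable def opX (i : Fin 2) : P2 K →ₗ[K] P2 K := LinearMap.mulLeft K (X i)
noncomputable def opD (i : Fin 2) : P2 K →ₗ[K] P2 K := (pderiv i).toLinearMap

lemma opX_apply (i : Fin 2) (f : P2 K) : opX i f = X i * f := rfl
lemma opD_apply (i : Fin 2) (f : P2 K) : opD i f = pderiv i f := rfl

lemma opDX_same (i : Fin 2) (f : P2 K) : opD i (opX i f) = f + opX i (opD i f) := by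
  simp [opX_apply, opD_apply, Derivation.leibniz, pderiv_X]; ring
lemma opDX_ne {i j : Fin 2} (h : j ≠ i) (f : P2 K) : opD i (opX j f) = opX j (opD i f) := by
  simp [opX_apply, opD_apply, Derivation.leibniz, pderiv_X, h]
lemma opXX (f : P2 K) : opX 1 (opX 0 f) = opX 0 (opX 1 f) := by
  simp [opX_apply]; ring
lemma opDD (f : P2 K) : opD 1 (opD 0 f) = opD 0 (opD 1 f) := by
  simp only [opD_apply]
  apply ext_cf
  intro i j
  simp only [cf_D0, cf_D1]; ring

noncomputable def E12 (K : Type) [Field K] : Module.End K (P2 K ⊗[K] P2 K) :=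
  TensorProduct.map (opX 0) (opD 0) + TensorProduct.map (opX 1) (opD 1)
noncomputable def E21 (K : Type) [Field K] : Module.End K (P2 K ⊗[K] P2 K) :=
  TensorProduct.map (opD 0) (opX 0) + TensorProduct.map (opD 1) (opX 1)
noncomputable def opN (K : Type) [Field K] : Module.End K (P2 K ⊗[K] P2 K) :=
  TensorProduct.map (opX 0 ∘ₗ opD 0 + opX 1 ∘ₗ opD 1) LinearMap.id -
  TensorProduct.map LinearMap.id (opX 0 ∘ₗ opD 0 + opX 1 ∘ₗ opD 1)

lemma E12_tmul (f g : P2 K) : E12 K (f ⊗ₜ g) = opX 0 f ⊗ₜ opD 0 g + opX 1 f ⊗ₜ opD 1 g := rfl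
lemma E21_tmul (f g : P2 K) : E21 K (f ⊗ₜ g) = opD 0 f ⊗ₜ opX 0 g + opD 1 f ⊗ₜ opX 1 g := rfl
lemma opN_tmul (f g : P2 K) : opN K (f ⊗ₜ g) = (opX 0 (opD 0 f) + opX 1 (opD 1 f)) ⊗ₜ g -
    f ⊗ₜ (opX 0 (opD 0 g) + opX 1 (opD 1 g)) := rfl

lemma E_comm (w : P2 K ⊗[K] P2 K) : E21 K (E12 K w) = E12 K (E21 K w) - opN K w := by
  induction w using TensorProduct.induction_on with
  | zero => simp
  | add x y hx hy => simp only [map_add, hx, hy]; abel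
  | tmul f g =>
    simp only [E12_tmul, E21_tmul, opN_tmul, map_add, opDX_same, opDX_ne (show (0 : Fin 2) ≠ 1 by decide),
      opDX_ne (show (1 : Fin 2) ≠ 0 by decide), TensorProduct.tmul_add, TensorProduct.add_tmul]
    abel

lemma N_comm (w : P2 K ⊗[K] P2 K) : opN K (E12 K w) = E12 K (opN K w) + (2 : K) • E12 K w := by
  induction w using TensorProduct.induction_on with
  | zero => simp
  | add x y hx hy => simp only [map_add, hx, hy, smul_add]; abel
  | tmul f g =>
    simp only [E12_tmul, opN_tmul, map_add, map_sub, opDX_same, opDX_ne (show (0 : Fin 2) ≠ 1 by decide),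
      opDX_ne (show (1 : Fin 2) ≠ 0 by decide), TensorProduct.tmul_add, TensorProduct.add_tmul,
      opXX, opDD]
    rw [two_smul]
    abel

lemma E12_nil (c : ℕ) : ∀ (f g : P2 K), g ∈ Hg K c → ((E12 K) ^ (c + 1)) (f ⊗ₜ g) = 0 := by
  induction c with
  | zero =>
    intro f g hg
    have hf : ∀ i, opD i g = 0 := by
      intro i
      rw [mem_homogeneousSubmodule, ← totalDegree_zero_iff_isHomogeneous, totalDegree_eq_zero_iff_eq_C] at hg
      rw [opD_apply, hg, pderiv_C]
    simp [E12_tmul, hf]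
  | succ c ih =>
    intro f g hg
    have h0 := ih (opX 0 f) (opD 0 g) (D_mem 0 hg)
    have h1 := ih (opX 1 f) (opD 1 g) (D_mem 1 hg)
    rw [pow_succ, Module.End.mul_apply, E12_tmul, map_add, h0, h1, add_zero]

lemma E21_inj_P (c : ℕ) (hlt : ∀ m : ℕ, 0 < m → m < c + 2 → (m : K) ≠ 0)
    (F : P2 K ⊗[K] P2 K) (hN : opN K F = F) (h0 : E21 K F = 0) (hnil : ((E12 K) ^ (c + 1)) F = 0) :
    F = 0 := by
  have h1 : ∀ j : ℕ, opN K (((E12 K) ^ j) F) = (1 + 2 * (j : K)) • ((E12 K) ^ j) F := by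
    intro j
    induction j with
    | zero => simp [hN]
    | succ j ih =>
      rw [pow_succ', Module.End.mul_apply, N_comm, ih, map_smul]
      push_cast; module
  have h2 : ∀ j : ℕ, E21 K (((E12 K) ^ (j + 1)) F) = (-((j : K) + 1) ^ 2) • ((E12 K) ^ j) F := by
    intro j
    induction j with
    | zero => simp [E_comm, h0, hN]; module
    | succ j ih =>
      rw [pow_succ', Module.End.mul_apply, E_comm, ih, h1, map_smul]
      rw [← Module.End.mul_apply, ← pow_succ']
      push_cast; module
  have h3 : ∀ j, j ≤ c + 1 → ((E12 K) ^ (c + 1 - j)) F = 0 := by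
    intro j
    induction j with
    | zero => intro _; simpa using hnil
    | succ j ih =>
      intro hj
      have := h2 (c + 1 - (j + 1))
      rw [show c + 1 - (j + 1) + 1 = c + 1 - j by omega, ih (by omega), map_zero] at this
      refine (smul_eq_zero.1 this.symm).resolve_left ?_
      have := hlt (c + 1 - (j + 1) + 1) (by omega) (by omega)
      exact neg_ne_zero.2 (pow_ne_zero _ (by exact_mod_cast this))
  simpa using h3 (c + 1) le_rfl

noncomputable def E21L (K : Type) [Field K] (c : ℕ) : Hg K (c+1) ⊗[K] Hg K c →ₗ[K] Hg K c ⊗[K] Hg K (c+1) :=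
  TensorProduct.map (mD 0 c) (mX 0 c) + TensorProduct.map (mD 1 c) (mX 1 c)

lemma E21L_inj (c : ℕ) (hlt : ∀ m : ℕ, 0 < m → m < c + 2 → (m : K) ≠ 0)
    (F : Hg K (c+1) ⊗[K] Hg K c) (h0 : E21L K c F = 0) : F = 0 := by
  let ι : Hg K (c+1) ⊗[K] Hg K c →ₗ[K] P2 K ⊗[K] P2 K :=
    TensorProduct.map (Hg K (c+1)).subtype (Hg K c).subtype
  have hι : Function.Injective ι := TensorProduct.map_injective_of_flat_flat _ _
    (Subtype.val_injective) (Subtype.val_injective)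
  let ι' : Hg K c ⊗[K] Hg K (c+1) →ₗ[K] P2 K ⊗[K] P2 K :=
    TensorProduct.map (Hg K c).subtype (Hg K (c+1)).subtype
  have e1 : ∀ w, E21 K (ι w) = ι' (E21L K c w) := by
    intro w
    induction w using TensorProduct.induction_on with
    | zero => simp
    | add x y hx hy => simp only [map_add, hx, hy]
    | tmul f g => rfl
  have e2 : ∀ w, opN K (ι w) = ι w := by
    intro w
    induction w using TensorProduct.induction_on with
    | zero => simp
    | add x y hx hy => simp only [map_add, hx, hy]
    | tmul f g =>
      have hf : opX 0 (opD 0 f.1) + opX 1 (opD 1 f.1) = _ := euler f.2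
      have hg : opX 0 (opD 0 g.1) + opX 1 (opD 1 g.1) = _ := euler g.2
      change opN K (f.1 ⊗ₜ g.1) = f.1 ⊗ₜ g.1
      rw [opN_tmul, hf, hg, TensorProduct.tmul_smul, ← TensorProduct.smul_tmul']
      push_cast; module
  have e3 : ∀ w, ((E12 K) ^ (c + 1)) (ι w) = 0 := by
    intro w
    induction w using TensorProduct.induction_on with
    | zero => simp
    | add x y hx hy => simp only [map_add, hx, hy, add_zero]
    | tmul f g => exact E12_nil c _ _ g.2
  apply hι
  rw [map_zero]
  exact E21_inj_P c hlt _ (e2 F) (by rw [e1, h0, map_zero]) (e3 F)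

end E21

section lemK
variable {K : Type} [Field K]
open MvPolynomial

lemma cf_mul_pow0 (f : P2 K) (n i j : ℕ) :
    cf i j (f * monomial (mon n 0) 1) = if n ≤ i then cf (i - n) j f else 0 := by
  rw [cf_apply, coeff_mul_monomial']
  by_cases h : n ≤ i
  · rw [if_pos h, if_pos, mul_one, cf_apply]
    · congr 1
      ext l; fin_cases l <;> simp
    · intro l; fin_cases l <;> simp [h]
  · rw [if_neg h, if_neg]
    intro hh
    exact h (by simpa using hh 0)

lemma cf_mul_pow1 (f : P2 K) (n i j : ℕ) :
    cf i j (f * monomial (mon 0 n) 1) = if n ≤ j then cf i (j - n) f else 0 := by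
  rw [cf_apply, coeff_mul_monomial']
  by_cases h : n ≤ j
  · rw [if_pos h, if_pos, mul_one, cf_apply]
    · congr 1
      ext l; fin_cases l <;> simp
    · intro l; fin_cases l <;> simp [h]
  · rw [if_neg h, if_neg]
    intro hh
    exact h (by simpa using hh 1)

lemma inj_pow {c : ℕ} {A B : P2 K} (hA : A ∈ Hg K (c+1)) (hB : B ∈ Hg K (c+1))
    (h : A * monomial (mon (c+2) 0) 1 + B * monomial (mon 0 (c+2)) 1 = 0) : A = 0 ∧ B = 0 := by
  constructor
  · apply ext_cf
    intro i j
    rw [map_zero]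
    by_cases hij : i + j = c + 1
    · have := congrArg (cf (i + (c + 2)) j) h
      rw [map_add, cf_mul_pow0, cf_mul_pow1, if_pos (by omega), if_neg (by omega), map_zero] at this
      simpa using this
    · exact hg_cf hA hij
  · apply ext_cf
    intro i j
    rw [map_zero]
    by_cases hij : i + j = c + 1
    · have := congrArg (cf i (j + (c + 2))) h
      rw [map_add, cf_mul_pow0, cf_mul_pow1, if_neg (by omega), if_pos (by omega), map_zero] at this
      simpa using this
    · exact hg_cf hB hij

noncomputable def pw0 (K : Type) [Field K] (n : ℕ) : Hg K n := ⟨monomial (mon n 0) 1, hg_monomial n 0 1⟩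
noncomputable def pw1 (K : Type) [Field K] (n : ℕ) : Hg K n :=
  ⟨monomial (mon 0 n) 1, by simpa using hg_monomial 0 n (1 : K)⟩

lemma lemK (c : ℕ) (hc : (c : K) + 2 = 0) (hlt : ∀ m : ℕ, 0 < m → m < c + 2 → (m : K) ≠ 0)
    (f h : Hg K (c+1)) (hfh : mD 1 c f = mD 0 c h) :
    ∃ (l : Hg K c) (a b : K), f = mX 1 c l + a • pw0 K (c+1) ∧ h = -mX 0 c l + b • pw1 K (c+1) := by
  have hl : ∀ i j, cf i j (divMonomial f.1 (Finsupp.single 1 1)) = cf i (j + 1) f.1 := by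
    intro i j
    rw [cf_apply, coeff_divMonomial, add_comm, mon_add_one, cf_apply]
  have key : ∀ i j : ℕ, ((j : K) + 1) * cf i (j + 1) f.1 = (i + 1) * cf (i + 1) j h.1 := by
    intro i j
    have := congrArg (fun q => cf i j q.1) hfh
    simpa only [mD_val, cf_D0, cf_D1] using this
  refine ⟨⟨divMonomial f.1 (Finsupp.single 1 1), hg_of_cf fun i j hij => ?_⟩,
    cf (c+1) 0 f.1, cf 0 (c+1) h.1, ?_, ?_⟩
  · rw [hl]; exact hg_cf f.2 (by omega)
  · apply Subtype.ext
    apply ext_cf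
    intro i j
    simp only [Submodule.coe_add, Submodule.coe_smul, mX_val, map_add, map_smul, pw0, cf_monomial]
    rcases j with _ | j
    · rw [cf_X1_mul_zero]
      by_cases hi : i = c + 1
      · simp [hi]
      · rw [hg_cf f.2 (by omega)]; simp [hi]
    · rw [cf_X1_mul, hl]; simp
  · apply Subtype.ext
    apply ext_cf
    intro i j
    simp only [Submodule.coe_add, Submodule.coe_smul, Submodule.coe_neg, mX_val, map_add, map_neg, map_smul, pw1,
      cf_monomial]
    rcases i with _ | i
    · rw [cf_X0_mul_zero]
      by_cases hi : j = c + 1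
      · simp [hi]
      · rw [hg_cf h.2 (by omega)]; simp [hi]
    · rw [cf_X0_mul, hl]
      by_cases hij : i + 1 + j = c + 1
      · have h1 := key i j
        have h2 : (j : K) + 1 = -(i + 1) := by
          have : ((i + 1 + j : ℕ) : K) = ((c + 1 : ℕ) : K) := by rw [hij]
          push_cast at this
          linear_combination this + hc
        have h3 : (i : K) + 1 ≠ 0 := by exact_mod_cast hlt (i + 1) (by omega) (by omega)
        rw [h2] at h1
        have : cf i (j + 1) f.1 = - cf (i + 1) j h.1 := by
          apply mul_left_cancel₀ h3
          linear_combination -h1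
        rw [this]; simp
      · rw [hg_cf f.2 (by omega), hg_cf h.2 hij]; simp

end lemK
end SLAlg

open CategoryTheory CategoryTheory.MonoidalCategory
open AlgebraicModule

namespace SLAlg
open Representation TensorProduct

section gen
variable {K G : Type} [Field K] [Group G]

noncomputable abbrev Rp.prod (X Y : Rp K G) : Rp K G := ⟨X.V × Y.V, X.ρ.prod Y.ρ⟩

lemma inAdd_prod (X Y : Rp K G) : InAdd (X.prod Y) {X, Y} := by
  have h1 := mem_thr (X := X.prod Y) (S := {X, Y}) (Y := X) (by simp)
    (IntertwiningMap.fst K X.ρ Y.ρ) (IntertwiningMap.inl K X.ρ Y.ρ)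
  have h2 := mem_thr (X := X.prod Y) (S := {X, Y}) (Y := Y) (by simp)
    (IntertwiningMap.snd K X.ρ Y.ρ) (IntertwiningMap.inr K X.ρ Y.ρ)
  have h3 := add_mem h1 h2
  rw [InAdd]
  convert h3 using 1
  ext v <;> simp

lemma equiv_of_inj {X Y : Rp K G} (f : Hm X Y) (hf : Function.Injective f)
    (hd : Module.finrank K X.V = Module.finrank K Y.V) : cl X = cl Y := by
  refine cl_eq.2 ⟨f.ofBijective ⟨hf, ?_⟩⟩
  exact (LinearMap.injective_iff_surjective_of_finrank_eq_finrank hd (f := f.toLinearMap)).1 hf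

variable (γ : G →* SL2 K)

noncomputable def omG {X Y : Rp K G} (T : Fin 2 → X.V →ₗ[K] Y.V)
    (hT : ∀ g i x, T i (X.ρ g x) = (γ g).1 i 0 • Y.ρ g (T 0 x) + (γ g).1 i 1 • Y.ρ g (T 1 x)) :
    Hm (two γ X) Y :=
  ⟨LinearMap.coprod (T 1) (-T 0), fun g => by
    apply LinearMap.ext; rintro ⟨f, h⟩
    have hd := det_eq (γ g)
    simp only [LinearMap.comp_apply, two_ρ, LinearMap.coprod_apply, map_add, map_smul, hT,
      LinearMap.neg_apply, map_neg]
    linear_combination (norm := module) hd • (Y.ρ g (T 1 f) - Y.ρ g (T 0 h))⟩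

lemma omG_apply {X Y : Rp K G} (T : Fin 2 → X.V →ₗ[K] Y.V) (hT) (a b : X.V) :
    omG γ (Y := Y) T hT (a, b) = T 1 a - T 0 b := by
  change LinearMap.coprod (T 1) (-T 0) (a, b) = _
  simp [sub_eq_add_neg]

noncomputable def twoMap {X Y : Rp K G} (f : Hm X Y) : Hm (two γ X) (two γ Y) :=
  ⟨LinearMap.prodMap f.toLinearMap f.toLinearMap, fun g => by
    apply LinearMap.ext; rintro ⟨a, b⟩
    have h := fun x => IntertwiningMap.isIntertwining _ _ f g x
    simp only [LinearMap.comp_apply, two_ρ, LinearMap.prodMap_apply, map_add, map_smul]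
    simp only [IntertwiningMap.coe_toLinearMap, h]⟩

lemma twoMap_apply {X Y : Rp K G} (f : Hm X Y) (a b : X.V) : twoMap γ f (a, b) = (f a, f b) := rfl

noncomputable def mulL (K : Type) [Field K] (a b : ℕ) : Hg K a ⊗[K] Hg K b →ₗ[K] Hg K (a + b) :=
  TensorProduct.lift (LinearMap.mk₂ K (fun f g => ⟨f.1 * g.1, MvPolynomial.IsHomogeneous.mul f.2 g.2⟩)
    (fun _ _ _ => Subtype.ext (add_mul _ _ _)) (fun _ _ _ => Subtype.ext (smul_mul_assoc _ _ _))
    (fun _ _ _ => Subtype.ext (mul_add _ _ _)) (fun _ _ _ => Subtype.ext (mul_smul_comm _ _ _)))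

lemma mulL_tmul (a b : ℕ) (f : Hg K a) (g : Hg K b) : (mulL K a b (f ⊗ₜ g)).1 = f.1 * g.1 := rfl

noncomputable def mulT (a b : ℕ) : Hm ((Sy γ a).tensor (Sy γ b)) (Sy γ (a + b)) :=
  ⟨mulL K a b, fun g => by
    apply TensorProduct.ext'
    intro f h
    apply Subtype.ext
    exact (map_mul (sub (γ g).1) f.1 h.1).symm⟩

/-- `1 ⊗ D_i` -/
lemma lD_eq (c : ℕ) (X : Rp K G) (g : G) (i : Fin 2) (x : X.V ⊗[K] Hg K (c+1)) :
    (LinearMap.lTensor X.V (mD i c)) ((X.tensor (Sy γ (c+1))).ρ g x) =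
      (γ g).1 i 0 • (X.tensor (Sy γ c)).ρ g (LinearMap.lTensor X.V (mD 0 c) x) +
      (γ g).1 i 1 • (X.tensor (Sy γ c)).ρ g (LinearMap.lTensor X.V (mD 1 c) x) := by
  induction x using TensorProduct.induction_on with
  | zero => simp
  | add x y hx hy => simp only [map_add, hx, hy, smul_add]; abel
  | tmul f h =>
    change X.ρ g f ⊗ₜ[K] (mD i c (syA (γ g) (c+1) h)) =
      (γ g).1 i 0 • X.ρ g f ⊗ₜ[K] (syA (γ g) c (mD 0 c h)) + (γ g).1 i 1 • X.ρ g f ⊗ₜ[K] (syA (γ g) c (mD 1 c h))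
    rw [sy_D, TensorProduct.tmul_add, TensorProduct.tmul_smul, TensorProduct.tmul_smul]

lemma rD_eq (c : ℕ) (X : Rp K G) (g : G) (i : Fin 2) (x : Hg K (c+1) ⊗[K] X.V) :
    (LinearMap.rTensor X.V (mD i c)) (((Sy γ (c+1)).tensor X).ρ g x) =
      (γ g).1 i 0 • ((Sy γ c).tensor X).ρ g (LinearMap.rTensor X.V (mD 0 c) x) +
      (γ g).1 i 1 • ((Sy γ c).tensor X).ρ g (LinearMap.rTensor X.V (mD 1 c) x) := by
  induction x using TensorProduct.induction_on with
  | zero => simp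
  | add x y hx hy => simp only [map_add, hx, hy, smul_add]; abel
  | tmul h f =>
    change (mD i c (syA (γ g) (c+1) h)) ⊗ₜ[K] X.ρ g f =
      (γ g).1 i 0 • (syA (γ g) c (mD 0 c h)) ⊗ₜ[K] X.ρ g f + (γ g).1 i 1 • (syA (γ g) c (mD 1 c h)) ⊗ₜ[K] X.ρ g f
    rw [sy_D, TensorProduct.add_tmul, ← TensorProduct.smul_tmul', ← TensorProduct.smul_tmul']

end gen

section T2
variable {K G : Type} [Field K] [Group G] (γ γ' : G →* SL2 K) (c : ℕ)
open MvPolynomial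

lemma pow_mon0 (n : ℕ) : (monomial (mon n 0) 1 : P2 K) = X 0 ^ n := by
  rw [X_pow_eq_monomial]; congr 1; simp [mon]
lemma pow_mon1 (n : ℕ) : (monomial (mon 0 n) 1 : P2 K) = X 1 ^ n := by
  rw [X_pow_eq_monomial]; congr 1; simp [mon]

noncomputable def psL (K : Type) [Field K] (c : ℕ) : Hg K (c+1) × Hg K (c+1) →ₗ[K] Hg K (c+1+(c+1)+1) :=
  LinearMap.coprod
    ((LinearMap.mulRight K (X 0 ^ (c+2))).restrict fun f hf => by
      have := MvPolynomial.IsHomogeneous.mul hf (isHomogeneous_X_pow (R := K) (0 : Fin 2) (c+2))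
      exact this)
    ((LinearMap.mulRight K (X 1 ^ (c+2))).restrict fun f hf => by
      have := MvPolynomial.IsHomogeneous.mul hf (isHomogeneous_X_pow (R := K) (1 : Fin 2) (c+2))
      exact this)

lemma psL_val (a b : Hg K (c+1)) : (psL K c (a, b)).1 = a.1 * X 0 ^ (c+2) + b.1 * X 1 ^ (c+2) := rfl

lemma sub_pow [Fact (c+2).Prime] [CharP K (c+2)] (A : Matrix (Fin 2) (Fin 2) K) (j : Fin 2) :
    sub A (X j ^ (c+2)) = A 0 j ^ (c+2) • X 0 ^ (c+2) + A 1 j ^ (c+2) • X 1 ^ (c+2) := by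
  rw [map_pow, sub_X, add_pow_char, smul_pow, smul_pow]

noncomputable def psT [Fact (c+2).Prime] [CharP K (c+2)]
    (h : ∀ g i j, (γ' g).1 i j = (γ g).1 i j ^ (c+2)) :
    Hm (two γ' (Sy γ (c+1))) (Sy γ (c+1+(c+1)+1)) :=
  ⟨psL K c, fun g => by
    apply LinearMap.ext; rintro ⟨a, b⟩
    apply Subtype.ext
    simp only [LinearMap.comp_apply, two_ρ, psL_val, syRep_apply, syA_val, map_add, map_mul, sub_pow, h]
    simp only [Submodule.coe_add, Submodule.coe_smul, syA_val, Algebra.smul_def]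
    ring⟩

lemma psL_inj {c : ℕ} {a b : Hg K (c+1)} (h : psL K c (a, b) = 0) : a = 0 ∧ b = 0 := by
  have := congrArg Subtype.val h
  rw [psL_val, ← pow_mon0, ← pow_mon1] at this
  obtain ⟨h1, h2⟩ := inj_pow a.2 b.2 this
  exact ⟨Subtype.ext h1, Subtype.ext h2⟩

lemma cl_ps [Fact (c+2).Prime] [CharP K (c+2)]
    (h : ∀ g i j, (γ' g).1 i j = (γ g).1 i j ^ (c+2)) :
    cl (Sy γ (c+1+(c+1)+1)) = cl (Vr γ') * cl (Sy γ (c+1)) := by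
  rw [← cl_two]
  symm
  refine equiv_of_inj (X := two γ' (Sy γ (c+1))) (psT γ γ' c h) ?_ ?_
  · refine (injective_iff_map_eq_zero (psL K c)).2 ?_
    rintro ⟨a, b⟩ hab
    obtain ⟨rfl, rfl⟩ := psL_inj hab
    rfl
  · simp only [Module.finrank_prod, finrank_hg]; omega

noncomputable def th1 : Hm (two γ ((Sy γ (c+1)).tensor (Sy γ (c+1)))) ((Sy γ (c+1)).tensor (Sy γ c)) :=
  omG γ (fun i => LinearMap.lTensor _ (mD i c)) (fun g i x => lD_eq γ c (Sy γ (c+1)) g i x)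
noncomputable def th2 : Hm (two γ ((Sy γ (c+1)).tensor (Sy γ (c+1)))) ((Sy γ c).tensor (Sy γ (c+1))) :=
  omG γ (fun i => LinearMap.rTensor _ (mD i c)) (fun g i x => rD_eq γ c (Sy γ (c+1)) g i x)
noncomputable def th3 : Hm (two γ ((Sy γ (c+1)).tensor (Sy γ (c+1)))) (Sy γ (c+1+(c+1)+1)) :=
  (multT γ (c+1+(c+1))).comp (twoMap γ (mulT γ (c+1) (c+1)))

lemma hg_basis (w : Hg K (c+1) ⊗[K] Hg K (c+1)) : ∃ f : Fin (Module.finrank K (Hg K (c+1))) → Hg K (c+1),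
    w = ∑ i, (Module.finBasis K (Hg K (c+1))) i ⊗ₜ[K] f i := by
  obtain ⟨f, hf⟩ := TensorProduct.eq_repr_basis_left (Module.finBasis K (Hg K (c+1))) w
  refine ⟨f, ?_⟩
  rw [← hf, Finsupp.sum_fintype _ _ (by simp)]

lemma hg_basis_eq {N : Type} [AddCommGroup N] [Module K N]
    (f g : Fin (Module.finrank K (Hg K (c+1))) → N)
    (h : ∑ i, (Module.finBasis K (Hg K (c+1))) i ⊗ₜ[K] f i =
      ∑ i, (Module.finBasis K (Hg K (c+1))) i ⊗ₜ[K] g i) (i) : f i = g i := by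
  have := congrArg (fun w => TensorProduct.lid K N
    (LinearMap.rTensor N ((Module.finBasis K (Hg K (c+1))).coord i) w)) h
  simpa [map_sum, Finsupp.single_apply, ite_smul] using this

lemma th_inj (hc : (c : K) + 2 = 0) (hlt : ∀ m : ℕ, 0 < m → m < c + 2 → (m : K) ≠ 0)
    (w0 w1 : Hg K (c+1) ⊗[K] Hg K (c+1)) 
    (h1 : LinearMap.lTensor _ (mD 1 c) w0 = LinearMap.lTensor _ (mD 0 c) w1)
    (h2 : LinearMap.rTensor _ (mD 1 c) w0 = LinearMap.rTensor _ (mD 0 c) w1)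
    (h3 : multL K _ (mulL K _ _ w0, mulL K _ _ w1) = 0) : w0 = 0 ∧ w1 = 0 := by
  set b := Module.finBasis K (Hg K (c+1)) with hb
  obtain ⟨f, hf⟩ := hg_basis c w0
  obtain ⟨h, hh⟩ := hg_basis c w1
  have hk : ∀ i, mD 1 c (f i) = mD 0 c (h i) := by
    intro i
    refine hg_basis_eq c (fun i => mD 1 c (f i)) (fun i => mD 0 c (h i)) ?_ i
    rw [hf, hh] at h1
    simpa [map_sum] using h1
  choose l A B hA hB using fun i => lemK c hc hlt _ _ (hk i)
  set F : Hg K (c+1) ⊗[K] Hg K c := ∑ i, b i ⊗ₜ[K] l i with hF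
  have e0 : w0 = LinearMap.lTensor _ (mX 1 c) F + (∑ i, A i • b i) ⊗ₜ[K] pw0 K (c+1) := by
    rw [hf, hF, map_sum, TensorProduct.sum_tmul, ← Finset.sum_add_distrib]
    refine Finset.sum_congr rfl fun i _ => ?_
    rw [hA i, TensorProduct.tmul_add, TensorProduct.tmul_smul, LinearMap.lTensor_tmul,
      TensorProduct.smul_tmul']
  have e1 : w1 + LinearMap.lTensor _ (mX 0 c) F = (∑ i, B i • b i) ⊗ₜ[K] pw1 K (c+1) := by
    rw [hh, hF, map_sum, TensorProduct.sum_tmul, ← Finset.sum_add_distrib]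
    refine Finset.sum_congr rfl fun i _ => ?_
    rw [LinearMap.lTensor_tmul, ← TensorProduct.tmul_add, hB i, TensorProduct.smul_tmul]
    congr 1
    abel
  have mm : ∀ (i : Fin 2) (F : Hg K (c+1) ⊗[K] Hg K c), (mulL K (c+1) (c+1) (LinearMap.lTensor _ (mX i c) F)).1
      = X i * (mulL K (c+1) c F).1 := by
    intro i F
    induction F using TensorProduct.induction_on with
    | zero => simp
    | add x y hx hy => simp only [map_add, Submodule.coe_add, hx, hy, mul_add]
    | tmul f g => rw [LinearMap.lTensor_tmul, mulL_tmul, mulL_tmul, mX_val]; ring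
  have hAB := psL_inj (a := ∑ i, A i • b i) (b := ∑ i, B i • b i) (by
    apply Subtype.ext
    have h3 := congrArg Subtype.val h3
    have e1' := congrArg (fun w => (mulL K (c+1) (c+1) w).1) e1
    simp only [map_add, Submodule.coe_add, mm, mulL_tmul, pw1, pow_mon1] at e1'
    rw [multL_apply, Submodule.coe_add, mX_val, mX_val, e0, map_add,
      Submodule.coe_add, mm, mulL_tmul, Submodule.coe_zero] at h3
    simp only [pw0, pow_mon0] at h3
    rw [psL_val, Submodule.coe_zero]
    linear_combination h3 - X 1 * e1')
  rw [hAB.1, TensorProduct.zero_tmul, add_zero] at e0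
  rw [hAB.2, TensorProduct.zero_tmul] at e1
  have hF0 : F = 0 := by
    apply E21L_inj c hlt
    have e2 := congrArg (LinearMap.rTensor _ (mD 0 c)) e1
    rw [map_add, ← h2, e0, ← LinearMap.comp_apply, ← LinearMap.comp_apply,
      LinearMap.rTensor_comp_lTensor, LinearMap.rTensor_comp_lTensor, map_zero] at e2
    rw [E21L, LinearMap.add_apply]; exact (add_comm _ _).trans e2
  rw [hF0, map_zero] at e0 e1
  exact ⟨e0, by simpa using e1⟩

theorem T2 [Fact (c+2).Prime] [CharP K (c+2)]
    (h : ∀ g i j, (γ' g).1 i j = (γ g).1 i j ^ (c+2)) :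
    CAdd (cl (Vr γ) * (cl (Sy γ (c+1)) * cl (Sy γ (c+1))))
      {cl (Sy γ (c+1)) * cl (Sy γ c), cl (Vr γ') * cl (Sy γ (c+1))} := by
  have hc : (c : K) + 2 = 0 := by
    have := CharP.cast_eq_zero K (c+2); exact_mod_cast this
  have hlt : ∀ m : ℕ, 0 < m → m < c + 2 → (m : K) ≠ 0 := by
    intro m h1 h2 h3
    rw [CharP.cast_eq_zero_iff K (c+2)] at h3
    exact absurd (Nat.le_of_dvd h1 h3) (by omega)
  let S := Sy γ (c+1)
  let Q : Rp K G := ((S.tensor (Sy γ c)).prod ((Sy γ c).tensor S)).prod (Sy γ (c+1+(c+1)+1))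
  have e : cl (two γ (S.tensor S)) = cl Q := by
    let Θ : Hm (two γ (S.tensor S)) Q := ((th1 γ c).prod (th2 γ c)).prod (th3 γ c)
    refine equiv_of_inj Θ ?_ ?_
    · refine (injective_iff_map_eq_zero Θ.toLinearMap).2 ?_
      rintro ⟨w0, w1⟩ hw
      have h1 : th1 γ c (w0, w1) = 0 := congrArg (fun q => q.1.1) hw
      have h2 : th2 γ c (w0, w1) = 0 := congrArg (fun q => q.1.2) hw
      have h3 : th3 γ c (w0, w1) = 0 := congrArg (fun q => q.2) hw
      rw [th1, omG_apply] at h1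
      rw [th2, omG_apply] at h2
      obtain ⟨rfl, rfl⟩ := th_inj c hc hlt w0 w1 (sub_eq_zero.1 h1) (sub_eq_zero.1 h2) h3
      rfl
    · change Module.finrank K ((Hg K (c+1) ⊗[K] Hg K (c+1)) × (Hg K (c+1) ⊗[K] Hg K (c+1))) =
        Module.finrank K (((Hg K (c+1) ⊗[K] Hg K c) × (Hg K c ⊗[K] Hg K (c+1))) × Hg K (c+1+(c+1)+1))
      simp only [Module.finrank_prod, Module.finrank_tensorProduct, finrank_hg]; ring
  rw [← cl_tensor, ← cl_two, e]
  refine .of_inAdd ((inAdd_prod _ _).trans ?_)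
  rintro Y (rfl | rfl)
  · refine (inAdd_prod _ _).trans ?_
    rintro Y (rfl | rfl)
    · exact .of_mem (Or.inl (cl_tensor _ _))
    · exact .of_mem (Or.inl ((cl_tensor _ _).trans (mul_comm _ _)))
  · exact .of_mem (Or.inr (cl_ps γ γ' c h))

end T2
end SLAlg

open CategoryTheory CategoryTheory.MonoidalCategory
open AlgebraicModule

namespace SLAlg
open Representation TensorProduct

section curry
variable {K G : Type} [Field K] [Group G]

noncomputable abbrev Rp.hom (Y M : Rp K G) : Rp K G := ⟨Y.V →ₗ[K] M.V, Y.ρ.linHom M.ρ⟩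

lemma hit_curry (X Y M : Rp K G) : Hit (X.tensor Y) M ↔ Hit X (Y.hom M) := by
  constructor
  · rintro ⟨f, hf⟩
    let f' : Hm X (Y.hom M) := ⟨TensorProduct.curry f.toLinearMap, fun g => by
      apply LinearMap.ext; intro x
      apply LinearMap.ext; intro y
      have := IntertwiningMap.isIntertwining _ _ f g (x ⊗ₜ Y.ρ g⁻¹ y)
      simp only [LinearMap.comp_apply, TensorProduct.curry_apply, linHom_apply]
      rw [Representation.tprod_apply, TensorProduct.map_tmul, Representation.self_inv_apply] at this
      exact this⟩
    refine ⟨f', fun h => hf ?_⟩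
    ext x y
    exact LinearMap.congr_fun (DFunLike.congr_fun h x) y
  · rintro ⟨f, hf⟩
    let f' : Hm (X.tensor Y) M := ⟨TensorProduct.lift f.toLinearMap, fun g => by
      apply TensorProduct.ext'; intro x y
      have := LinearMap.congr_fun (IntertwiningMap.isIntertwining _ _ f g x) (Y.ρ g y)
      rw [linHom_apply] at this
      simp only [LinearMap.comp_apply, Representation.tprod_apply, TensorProduct.map_tmul,
        TensorProduct.lift.tmul]
      simp only [LinearMap.comp_apply, Representation.inv_self_apply] at this
      exact this⟩
    refine ⟨f', fun h => hf ?_⟩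
    refine DFunLike.ext _ _ fun x => ?_
    apply LinearMap.ext; intro y
    exact DFunLike.congr_fun h (x ⊗ₜ y)

end curry

section T3
variable {K G : Type} [Field K] [Group G] (γ γ' : G →* SL2 K) (c : ℕ)
open MvPolynomial

lemma kaL_inj {f : Hg K c} (h : kaL K c f = 0) : f = 0 := by
  have := congrArg (fun q => q.1.1) h
  rw [kaL_apply] at this
  simp only [mX_val] at this
  apply Subtype.ext
  simpa using this

lemma mult_pw (a b : K) (h : multL K (c+1) (a • pw0 K (c+1), b • pw1 K (c+1)) = 0) : a = 0 ∧ b = 0 := by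
  have h := congrArg Subtype.val h
  rw [multL_apply, Submodule.coe_add, mX_val, mX_val] at h
  constructor
  · have := congrArg (cf (c+2) 0) h
    rw [map_add, cf_X0_mul, cf_X1_mul_zero] at this
    simpa [pw0, cf_monomial] using this
  · have := congrArg (cf 0 (c+2)) h
    rw [map_add, cf_X1_mul, cf_X0_mul_zero] at this
    simpa [pw1, cf_monomial] using this

lemma mult_ka (f : Hg K c) : multL K (c+1) (kaL K c f) = 0 := by
  apply Subtype.ext
  rw [kaL_apply, multL_apply, Submodule.coe_add, mX_val, mX_val, map_neg, Submodule.coe_neg, mX_val, mX_val, Submodule.coe_zero]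
  ring

lemma om_ker (hc : (c : K) + 2 = 0) (hlt : ∀ m : ℕ, 0 < m → m < c + 2 → (m : K) ≠ 0)
    (w : Hg K (c+1) × Hg K (c+1)) (h : omL K c w = 0) :
    ∃ (l : Hg K c) (a b : K), w = kaL K c l + (a • pw0 K (c+1), b • pw1 K (c+1)) := by
  obtain ⟨f, h'⟩ := w
  rw [omL_apply, sub_eq_zero] at h
  obtain ⟨l, a, b, h1, h2⟩ := lemK c hc hlt f h' h
  exact ⟨l, a, b, by rw [kaL_apply, h1, h2]; rfl⟩

lemma mult_ker (hc : (c : K) + 2 = 0) (hlt : ∀ m : ℕ, 0 < m → m < c + 2 → (m : K) ≠ 0)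
    (w : Hg K (c+1) × Hg K (c+1)) (h : multL K (c+1) w = 0) :
    ∃ l, w = kaL K c l := by
  have h1 := pol_mult c w
  rw [h, hc, zero_smul, map_zero, zero_add] at h1
  obtain ⟨l, a, b, rfl⟩ := om_ker c hc hlt w (kaL_inj c h1)
  rw [map_add, mult_ka, zero_add] at h
  obtain ⟨rfl, rfl⟩ := mult_pw c a b h
  exact ⟨l, by simp⟩

lemma mD_surj (hlt : ∀ m : ℕ, 0 < m → m < c + 2 → (m : K) ≠ 0) :
    Function.Surjective (mD (K := K) 1 c) := by
  intro l
  let f := (hgEquiv K (c+1)).symm fun i => cf i (c - i) l.1 / ((c + 1 - i : ℕ) : K)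
  refine ⟨f, Subtype.ext (ext_cf fun i j => ?_)⟩
  rw [mD_val, cf_D1]
  by_cases hij : i + j = c
  · have := congrFun ((hgEquiv K (c+1)).apply_symm_apply
      fun i => cf i (c - i) l.1 / ((c + 1 - i : ℕ) : K)) ⟨i, by omega⟩
    change cf i (c + 1 - i) f.1 = cf i (c - i) l.1 / ((c + 1 - i : ℕ) : K) at this
    rw [show c + 1 - i = j + 1 by omega, show c - i = j by omega] at this
    have h0 := hlt (j+1) (by omega) (by omega)
    rw [this]
    push_cast at h0 ⊢
    field_simp
  · rw [hg_cf l.2 hij, hg_cf f.2 (by omega), mul_zero]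

lemma T3_base [Fact (c+2).Prime] [CharP K (c+2)]
    (h : ∀ g i j, (γ' g).1 i j = (γ g).1 i j ^ (c+2)) (Z : Rp K G)
    (hZ : Hit (two γ (Sy γ (c+1))) Z) : Hit (Sy γ c) Z ∨ Hit (Vr γ') Z := by
  have hc : (c : K) + 2 = 0 := by
    have := CharP.cast_eq_zero K (c+2); exact_mod_cast this
  have hlt : ∀ m : ℕ, 0 < m → m < c + 2 → (m : K) ≠ 0 := by
    intro m h1 h2 h3
    rw [CharP.cast_eq_zero_iff K (c+2)] at h3
    exact absurd (Nat.le_of_dvd h1 h3) (by omega)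
  by_contra! hcon
  obtain ⟨hL, hV⟩ := hcon
  obtain ⟨φ, hφ⟩ := hZ
  have z1 : ∀ q : Hm (Sy γ c) Z, q = 0 := fun q => by
    by_contra hq; exact hL ⟨q, hq⟩
  have z2 : ∀ q : Hm (Vr γ') Z, q = 0 := fun q => by
    by_contra hq; exact hV ⟨q, hq⟩
  have hka : ∀ l, φ (kaL K c l) = 0 := fun l => DFunLike.congr_fun (z1 (φ.comp (kaT γ c))) l
  have hmk : ∀ w, multL K (c+1) w = 0 → φ w = 0 := by
    intro w hw
    obtain ⟨l, rfl⟩ := mult_ker c hc hlt w hw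
    exact hka l
  let j : K × K →ₗ[K] Hg K (c+1) × Hg K (c+1) :=
    LinearMap.prodMap (LinearMap.toSpanSingleton K _ (pw0 K (c+1))) (LinearMap.toSpanSingleton K _ (pw1 K (c+1)))
  have hj : ∀ a b, j (a, b) = (a • pw0 K (c+1), b • pw1 K (c+1)) := fun a b => rfl
  have hmj : ∀ a b, (multL K (c+1) (j (a, b))).1 = a • X 0 ^ (c+2) + b • X 1 ^ (c+2) := by
    intro a b
    rw [hj, multL_apply, Submodule.coe_add, mX_val, mX_val]
    simp only [Submodule.coe_smul, pw0, pw1, pow_mon0, pow_mon1, Algebra.smul_def]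
    ring
  let ψ : Hm (Vr γ') Z := ⟨φ.toLinearMap ∘ₗ j, fun g => by
    apply LinearMap.ext; rintro ⟨a, b⟩
    have h1 := IntertwiningMap.isIntertwining _ _ φ g (j (a, b))
    have h2 := IntertwiningMap.isIntertwining _ _ (multT γ (c+1)) g (j (a, b))
    change φ (j (twoRep γ' _ g (a, b))) = Z.ρ g (φ (j (a, b)))
    rw [← h1, ← sub_eq_zero, ← map_sub]
    apply hmk
    rw [map_sub, sub_eq_zero]
    refine Eq.trans ?_ h2.symm
    apply Subtype.ext
    rw [two_ρ, hmj]
    change _ = sub (γ g).1 (multL K (c+1) (j (a, b))).1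
    rw [hmj, map_add, map_smul, map_smul, sub_pow, sub_pow, h, h, h, h]
    simp only [Representation.trivial_apply, Algebra.smul_def, map_add, map_mul, Algebra.algebraMap_self_apply, LinearMap.id_apply, smul_eq_mul]
    ring⟩
  have hψ : ∀ a b, φ (j (a, b)) = 0 := fun a b => DFunLike.congr_fun (z2 ψ) (a, b)
  have hom : ∀ w, omL K c w = 0 → φ w = 0 := by
    intro w hw
    obtain ⟨l, a, b, rfl⟩ := om_ker c hc hlt w hw
    rw [map_add, hka, zero_add]; exact hψ a b
  obtain ⟨s, hs⟩ := LinearMap.exists_rightInverse_of_surjective (mD (K := K) 1 c)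
    (LinearMap.range_eq_top.2 (mD_surj c hlt))
  have hs' : ∀ l, mD 1 c (s l) = l := fun l => LinearMap.congr_fun hs l
  have hos : ∀ l, omL K c (s l, 0) = l := fun l => by rw [omL_apply, map_zero, sub_zero, hs']
  have hfac : ∀ w, φ w = φ (s (omL K c w), 0) := by
    intro w
    rw [← sub_eq_zero, ← map_sub]
    apply hom
    rw [map_sub, hos, sub_self]
  let χ : Hm (Sy γ c) Z := ⟨φ.toLinearMap ∘ₗ LinearMap.inl K _ _ ∘ₗ s, fun g => by
    apply LinearMap.ext; intro l
    have h1 := IntertwiningMap.isIntertwining _ _ φ g (s l, 0)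
    have h2 := IntertwiningMap.isIntertwining _ _ (omT γ c) g (s l, 0)
    have h3 : omL K c (s l, 0) = l := hos l
    change omL K c ((two γ (Sy γ (c+1))).ρ g (s l, 0)) = syA (γ g) c (omL K c (s l, 0)) at h2
    change φ (s (syA (γ g) c l), 0) = Z.ρ g (φ (s l, 0))
    rw [← h1, hfac ((two γ (Sy γ (c+1))).ρ g (s l, 0)), h2, hos]⟩
  apply hφ
  refine DFunLike.ext _ _ fun w => ?_
  have := DFunLike.congr_fun (z1 χ) (omL K c w)
  rw [hfac]; exact this

theorem T3 [Fact (c+2).Prime] [CharP K (c+2)]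
    (h : ∀ g i j, (γ' g).1 i j = (γ g).1 i j ^ (c+2)) (M : Rp K G) (y : Cl K G)
    (hM : CHit (cl (Vr γ) * cl (Sy γ (c+1)) * y) M) :
    CHit (cl (Sy γ c) * y) M ∨ CHit (cl (Vr γ') * y) M := by
  obtain ⟨Y, rfl⟩ := cl_surj y
  obtain ⟨X, hX, hh⟩ := hM
  rw [← cl_two, ← cl_tensor] at hX
  have := hh.of_cl hX
  rw [hit_curry] at this
  rcases T3_base γ γ' c h _ this with h1 | h1
  · exact Or.inl ⟨_, cl_tensor _ _, (hit_curry _ _ _).2 h1⟩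
  · exact Or.inr ⟨_, cl_tensor _ _, (hit_curry _ _ _).2 h1⟩

end T3
end SLAlg

open CategoryTheory CategoryTheory.MonoidalCategory
open AlgebraicModule

namespace SLAlg
open Representation TensorProduct

section comb
variable {K G : Type} [Field K] [Group G]

lemma CAdd.trans1 {a b : Cl K G} {T : Set (Cl K G)} (h : CAdd a {b}) (hS : CAdd b T) :
    CAdd a T := h.trans (by rintro _ rfl; exact hS)

lemma CAdd.mul1 {a b a' b' : Cl K G} (h : CAdd a {b}) (h' : CAdd a' {b'}) :
    CAdd (a * a') {b * b'} := by
  refine (h.mul h').mono ?_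
  rintro _ ⟨_, rfl, _, rfl, rfl⟩; rfl

lemma CAdd.prod {ι : Type} [DecidableEq ι] (x : ι → Cl K G) (S : ι → Set (Cl K G)) (s : Finset ι)
    (h : ∀ i ∈ s, CAdd (x i) (S i)) :
    CAdd (∏ i ∈ s, x i) {y | ∃ z : ι → Cl K G, (∀ i ∈ s, z i ∈ S i) ∧ y = ∏ i ∈ s, z i} := by
  induction s using Finset.induction_on with
  | empty => exact .of_mem ⟨x, by simp, by simp⟩
  | insert a s ha ih =>
    rw [Finset.prod_insert ha]
    refine ((h a (by simp)).mul (ih fun i hi => h i (by simp [hi]))).mono ?_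
    rintro _ ⟨b, hb, _, ⟨z, hz, rfl⟩, rfl⟩
    have hne : ∀ i ∈ s, i ≠ a := fun i hi h => ha (h ▸ hi)
    refine ⟨Function.update z a b, ?_, ?_⟩
    · intro i hi
      rcases Finset.mem_insert.1 hi with rfl | hi
      · simpa using hb
      · rw [Function.update_of_ne (hne i hi)]; exact hz i hi
    · rw [Finset.prod_insert ha, Function.update_self]
      congr 1
      exact Finset.prod_congr rfl fun i hi => by rw [Function.update_of_ne (hne i hi)]

variable (γ γ' : G →* SL2 K) (c : ℕ) [Fact (c+2).Prime] [CharP K (c+2)]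

lemma cast_ne (m : ℕ) (h1 : 0 < m) (h2 : m < c + 2) : (m : K) ≠ 0 := by
  intro h3
  rw [CharP.cast_eq_zero_iff K (c+2)] at h3
  exact absurd (Nat.le_of_dvd h1 h3) (by omega)

lemma Sret (a : ℕ) (ha : a ≤ c + 1) : CAdd (cl (Sy γ a)) {cl (Vr γ) ^ a} := by
  induction a with
  | zero => rw [cl_sy0, pow_zero]; exact .of_mem rfl
  | succ a ih =>
    have h0 : (a : K) + 1 ≠ 0 := by exact_mod_cast cast_ne (K := K) c (a+1) (by omega) (by omega)
    refine (T1_ret γ a h0).trans1 ?_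
    rw [pow_succ']
    exact CAdd.mul1 (.of_mem rfl) (ih (by omega))

lemma powS (r : ℕ) (hr : r ≤ c + 1) : CAdd (cl (Vr γ) ^ r) {x | ∃ a ≤ r, x = cl (Sy γ a)} := by
  induction r with
  | zero => exact .of_mem ⟨0, le_rfl, by rw [cl_sy0, pow_zero]⟩
  | succ r ih =>
    rw [pow_succ]
    refine (ih (by omega)).mul_right _ ?_
    rintro _ ⟨a, ha, rfl⟩
    rw [mul_comm]
    rcases a with _ | a
    · refine (T1_zero γ).mono ?_
      rintro _ rfl
      exact ⟨1, by omega, rfl⟩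
    · have h0 : (a : K) + 2 ≠ 0 := by exact_mod_cast cast_ne (K := K) c (a+2) (by omega) (by omega)
      refine (T1_succ γ a h0).mono ?_
      rintro _ (rfl | rfl)
      · exact ⟨a + 2, by omega, rfl⟩
      · exact ⟨a, by omega, rfl⟩

lemma P1 (h : ∀ g i j, (γ' g).1 i j = (γ g).1 i j ^ (c+2)) :
    CAdd (cl (Vr γ) ^ (2*c+3)) {x | ∃ a b, a + b < 2*c+3 ∧ x = cl (Vr γ) ^ a * cl (Vr γ') ^ b} := by
  have e : cl (Vr γ) ^ (2*c+3) = (cl (Vr γ) ^ (c+1) * cl (Vr γ) ^ (c+1)) * cl (Vr γ) := by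
    rw [← pow_add, ← pow_succ]; congr 1; omega
  rw [e]
  refine ((powS γ c (c+1) le_rfl).mul (powS γ c (c+1) le_rfl)).mul_right _ ?_
  rintro _ ⟨_, ⟨a, ha, rfl⟩, _, ⟨b, hb, rfl⟩, rfl⟩
  by_cases hab : a = c + 1 ∧ b = c + 1
  · obtain ⟨rfl, rfl⟩ := hab
    rw [mul_comm]
    refine (T2 γ γ' c h).trans ?_
    rintro _ (rfl | rfl)
    · refine (CAdd.mul1 (Sret γ c (c+1) le_rfl) (Sret γ c c (by omega))).mono ?_
      rintro _ rfl
      exact ⟨c+1+c, 0, by omega, by rw [pow_zero, mul_one, ← pow_add]⟩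
    · refine (CAdd.mul1 (.of_mem rfl) (Sret γ c (c+1) le_rfl)).mono ?_
      rintro _ rfl
      exact ⟨c+1, 1, by omega, by rw [pow_one, mul_comm]⟩
  · refine (CAdd.mul1 (CAdd.mul1 (Sret γ c a ha) (Sret γ c b hb)) (.of_mem rfl)).mono ?_
    rintro _ rfl
    exact ⟨a+b+1, 0, by omega, by rw [pow_zero, mul_one, pow_succ, pow_add]⟩

variable {n : ℕ} [NeZero n] (δ : Fin n → G →* SL2 K)

noncomputable def vv (m : Fin n → ℕ) : Cl K G := ∏ i, cl (Vr (δ i)) ^ m i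

lemma vv_add (m m' : Fin n → ℕ) : vv δ (m + m') = vv δ m * vv δ m' := by
  simp [vv, pow_add, Finset.prod_mul_distrib]

lemma vv_single (i : Fin n) (a : ℕ) : vv δ (Pi.single i a) = cl (Vr (δ i)) ^ a := by
  rw [vv, Finset.prod_eq_single i]
  · simp
  · intro b _ hb; simp [hb]
  · simp

lemma sum_single (i : Fin n) (a : ℕ) : ∑ j, (Pi.single i a : Fin n → ℕ) j = a := by simp

lemma split_at (m : Fin n → ℕ) (i : Fin n) (r : ℕ) (h : r ≤ m i) : ∃ m0 : Fin n → ℕ, m = Pi.single i r + m0 := by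
  refine ⟨m - Pi.single i r, ?_⟩
  ext j
  by_cases hj : j = i
  · subst hj; simp [h]
  · simp [hj]

theorem vv_bdd (hδ : ∀ i g a b, (δ (i+1) g).1 a b = (δ i g).1 a b ^ (c+2)) (N : ℕ) :
    ∀ m : Fin n → ℕ, ∑ i, m i = N → CAdd (vv δ m) {x | ∃ m', (∀ i, m' i ≤ 2*c+2) ∧ x = vv δ m'} := by
  induction N using Nat.strong_induction_on with
  | _ N ih =>
  intro m hm
  by_cases hb : ∀ i, m i ≤ 2*c+2
  · exact .of_mem ⟨m, hb, rfl⟩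
  push Not at hb
  obtain ⟨i, hi⟩ := hb
  obtain ⟨m0, rfl⟩ := split_at m i (2*c+3) hi
  rw [vv_add, vv_single]
  refine (P1 (δ i) (δ (i+1)) c (hδ i)).mul_right _ ?_
  rintro _ ⟨a, b, hab, rfl⟩
  have : cl (Vr (δ i)) ^ a * cl (Vr (δ (i+1))) ^ b * vv δ m0 = vv δ (Pi.single i a + Pi.single (i+1) b + m0) := by
    rw [vv_add, vv_add, vv_single, vv_single]
  rw [this]
  refine ih _ ?_ _ rfl
  simp only [Pi.add_apply, Finset.sum_add_distrib, sum_single] at hm ⊢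
  omega

lemma prodS_ret (m : Fin n → ℕ) (hm : ∀ i, m i ≤ c + 1) :
    CAdd (∏ i, cl (Sy (δ i) (m i))) {vv δ m} := by
  refine (CAdd.prod _ (fun i => {cl (Vr (δ i)) ^ m i}) _ fun i _ => Sret (δ i) c (m i) (hm i)).mono ?_
  rintro _ ⟨z, hz, rfl⟩
  exact Finset.prod_congr rfl fun i hi => hz i hi

lemma CHit.of_cadd1 {a b : Cl K G} {M : Rp K G} (h : CAdd a {b}) (hX : CHit a M) : CHit b M := by
  obtain ⟨_, rfl, h1⟩ := hX.of_cadd h; exact h1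

theorem classify (hδ : ∀ i g a b, (δ (i+1) g).1 a b = (δ i g).1 a b ^ (c+2)) (M : Rp K G) (N : ℕ) :
    ∀ m : Fin n → ℕ, ∑ i, m i = N → CHit (vv δ m) M →
      ∃ a : Fin n → ℕ, (∀ i, a i ≤ c + 1) ∧ CHit (∏ i, cl (Sy (δ i) (a i))) M := by
  induction N using Nat.strong_induction_on with
  | _ N ih =>
  intro m hm hM
  by_cases hb : ∀ i, m i ≤ c+1
  · have h1 := CAdd.prod (fun i => cl (Vr (δ i)) ^ m i) _ Finset.univ fun i _ => powS (δ i) c (m i) (hb i)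
    obtain ⟨_, ⟨z, hz, rfl⟩, hh⟩ := hM.of_cadd h1
    choose a ha ha' using fun i => hz i (Finset.mem_univ i)
    refine ⟨a, fun i => (ha i).trans (hb i), ?_⟩
    rwa [Finset.prod_congr rfl fun i _ => ha' i] at hh
  push Not at hb
  obtain ⟨i, hi⟩ := hb
  obtain ⟨m0, rfl⟩ := split_at m i (c+2) hi
  have fin : ∀ r < c + 2, CHit (cl (Vr (δ i)) ^ r * vv δ m0) M →
      ∃ a : Fin n → ℕ, (∀ i, a i ≤ c + 1) ∧ CHit (∏ i, cl (Sy (δ i) (a i))) M := by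
    intro r hr hh
    rw [← vv_single, ← vv_add] at hh
    refine ih _ ?_ _ rfl hh
    simp only [Pi.add_apply, Finset.sum_add_distrib, sum_single] at hm ⊢
    omega
  rw [vv_add, vv_single, pow_succ, mul_assoc] at hM
  obtain ⟨_, ⟨_, ⟨a, ha, rfl⟩, _, rfl, rfl⟩, hh⟩ := hM.of_cadd ((powS (δ i) c (c+1) le_rfl).mul (.of_mem (S := {_}) rfl))
  by_cases hac : a = c + 1
  · subst hac
    rw [← mul_assoc, mul_comm (cl _) (cl _)] at hh
    rcases T3 (δ i) (δ (i+1)) c (hδ i) M _ hh with h1 | h1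
    · exact fin c (by omega) (h1.of_cadd1 (CAdd.mul1 (Sret (δ i) c c (by omega)) (.of_mem rfl)))
    · have : cl (Vr (δ (i+1))) * vv δ m0 = vv δ (Pi.single (i+1) 1 + m0) := by
        rw [vv_add, vv_single, pow_one]
      rw [this] at h1
      refine ih _ ?_ _ rfl h1
      simp only [Pi.add_apply, Finset.sum_add_distrib, sum_single] at hm ⊢
      omega
  · refine fin (a + 1) (by omega) ?_
    rw [pow_succ, mul_assoc]
    exact hh.of_cadd1 (CAdd.mul1 (Sret (δ i) c a (by omega)) (.of_mem rfl))

end comb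
end SLAlg

open CategoryTheory CategoryTheory.MonoidalCategory
open AlgebraicModule

namespace SLAlg
open Representation TensorProduct

section T5
variable {K G : Type} [Field K] [Group G]

def Co (v : Cl K G) (r : ℕ) (f : G → K) : Prop :=
  ∃ X : Rp K G, cl X = v ^ r ∧ ∃ (x : X.V) (ξ : X.V →ₗ[K] K), f = fun g => ξ (X.ρ g⁻¹ x)

lemma Co.one (v : Cl K G) : Co v 0 1 := by
  refine ⟨Rp.unit K G, by rw [cl_unit, pow_zero], (1 : K), LinearMap.id, ?_⟩
  funext g
  simp

lemma Co.mul {v : Cl K G} {r s : ℕ} {f f' : G → K} (h : Co v r f) (h' : Co v s f') :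
    Co v (r + s) (f * f') := by
  obtain ⟨X, hX, x, ξ, rfl⟩ := h
  obtain ⟨Y, hY, y, η, rfl⟩ := h'
  refine ⟨X.tensor Y, by rw [cl_tensor, hX, hY, pow_add], x ⊗ₜ y,
    (TensorProduct.lid K K).toLinearMap ∘ₗ TensorProduct.map ξ η, ?_⟩
  funext g
  simp

lemma Co.ann [Finite G] {v : Cl K G} {r : ℕ} {f : G → K} (h : Co v r f) (M : Rp K G)
    (hM : ¬ CHit (v ^ r) M) (m : M.V) : ∑ᶠ g, f g • M.ρ g m = 0 := by
  have := Fintype.ofFinite G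
  obtain ⟨X, hX, x, ξ, rfl⟩ := h
  rw [finsum_eq_sum_of_fintype]
  let φ : Hm X M := ⟨∑ g : G, LinearMap.toSpanSingleton K _ (M.ρ g m) ∘ₗ ξ ∘ₗ X.ρ g⁻¹, fun h => by
    apply LinearMap.ext; intro x
    simp only [LinearMap.comp_apply, LinearMap.sum_apply, LinearMap.toSpanSingleton_apply, map_sum, map_smul]
    rw [← Equiv.sum_comp (Equiv.mulLeft h)]
    refine Finset.sum_congr rfl fun g _ => ?_
    simp [mul_inv_rev, map_mul]⟩
  have h0 : φ = 0 := by
    by_contra h0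
    exact hM ⟨X, hX, φ, h0⟩
  have := DFunLike.congr_fun h0 x
  change (∑ g : G, LinearMap.toSpanSingleton K _ (M.ρ g m) ∘ₗ ξ ∘ₗ X.ρ g⁻¹) x = 0 at this
  simpa using this

variable (γ : G →* SL2 K)

lemma Co.entry (i j : Fin 2) : Co (cl (Vr γ)) 1 (fun g => (γ g⁻¹).1 i j) := by
  refine ⟨Vr γ, by rw [pow_one], ?_⟩
  fin_cases j
  · refine ⟨((1 : K), (0 : K)), ?_⟩
    fin_cases i
    · exact ⟨LinearMap.fst K K K, by funext g; simp [two_ρ]⟩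
    · exact ⟨LinearMap.snd K K K, by funext g; simp [two_ρ]⟩
  · refine ⟨((0 : K), (1 : K)), ?_⟩
    fin_cases i
    · exact ⟨LinearMap.fst K K K, by funext g; simp [two_ρ]⟩
    · exact ⟨LinearMap.snd K K K, by funext g; simp [two_ρ]⟩

theorem T5 [Finite G] (hγ : Function.Injective γ) (M : Rp K G) (m : M.V) (hm : m ≠ 0) :
    ∃ r, CHit (cl (Vr γ) ^ r) M := by
  classical
  have := Fintype.ofFinite G
  by_contra! hcon
  let S : Set (G → K) := {f | ∃ i j, f = fun g => (γ g⁻¹).1 i j}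
  let Ann : Submodule K (G → K) :=
    { carrier := {f | ∑ g, f g • M.ρ g m = 0}
      add_mem' := by
        intro a b ha hb
        simp only [Set.mem_setOf_eq] at *
        simp [add_smul, Finset.sum_add_distrib, ha, hb]
      zero_mem' := by simp
      smul_mem' := by
        intro c x hx
        simp only [Set.mem_setOf_eq] at *
        simp [mul_smul, ← Finset.smul_sum, hx] }
  have h1 : Subalgebra.toSubmodule (Algebra.adjoin K S) ≤ Ann := by
    rw [Algebra.adjoin_eq_span, Submodule.span_le]
    intro f hf
    have : ∃ r, Co (cl (Vr γ)) r f := by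
      induction hf using Submonoid.closure_induction with
      | mem f hf => obtain ⟨i, j, rfl⟩ := hf; exact ⟨1, Co.entry γ i j⟩
      | one => exact ⟨0, Co.one _⟩
      | mul x y _ _ hx hy =>
        obtain ⟨r, hr⟩ := hx
        obtain ⟨s, hs⟩ := hy
        exact ⟨_, hr.mul hs⟩
    obtain ⟨r, hr⟩ := this
    have := hr.ann M (hcon r) m
    rwa [finsum_eq_sum_of_fintype] at this
  have h2 : ∀ h : G, h ≠ 1 → ∃ f ∈ Algebra.adjoin K S, f 1 = 1 ∧ f h = 0 := by
    intro h hh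
    have : ∃ i j, (γ h⁻¹).1 i j ≠ (γ 1).1 i j := by
      by_contra! hc
      apply hh
      have : γ h⁻¹ = γ 1 := by ext i j; exact hc i j
      simpa using hγ this
    obtain ⟨i, j, hij⟩ := this
    let e : G → K := fun g => (γ g⁻¹).1 i j
    have he : e ∈ S := ⟨i, j, rfl⟩
    refine ⟨((γ 1).1 i j - (γ h⁻¹).1 i j)⁻¹ • (e - algebraMap K (G → K) ((γ h⁻¹).1 i j)), ?_, ?_, ?_⟩
    · exact Subalgebra.smul_mem _ (Subalgebra.sub_mem _ (Algebra.subset_adjoin he)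
        (Subalgebra.algebraMap_mem _ _)) _
    · have : (γ 1).1 i j - (γ h⁻¹).1 i j ≠ 0 := sub_ne_zero.2 hij.symm
      simp only [Pi.smul_apply, Pi.sub_apply, e, Pi.algebraMap_apply, Algebra.algebraMap_self_apply, smul_eq_mul, inv_one]
      exact inv_mul_cancel₀ this
    · simp [e]
  choose! f hf hf1 hf0 using h2
  let d : G → K := ∏ h ∈ Finset.univ.erase 1, f h
  have hd : d ∈ Algebra.adjoin K S := Subalgebra.prod_mem _ fun h hh => hf h (Finset.ne_of_mem_erase hh)
  have hd' : ∑ g, d g • M.ρ g m = 0 := h1 hd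
  rw [Finset.sum_eq_single 1] at hd'
  · have : d 1 = 1 := by
      simp only [d, Finset.prod_apply]
      exact Finset.prod_eq_one fun h hh => hf1 h (Finset.ne_of_mem_erase hh)
    apply hm
    simpa [this] using hd'
  · intro g _ hg
    have : d g = 0 := by
      simp only [d, Finset.prod_apply]
      exact Finset.prod_eq_zero (i := g) (by simp [hg]) (hf0 g hg)
    rw [this, zero_smul]
  · simp

end T5
end SLAlg

open CategoryTheory CategoryTheory.MonoidalCategory
open AlgebraicModule

namespace SLAlg
open Representation TensorProduct

section T4
variable {K G : Type} [Field K] [Group G]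

open MvPolynomial in
lemma mon_pow (i j : ℕ) : (monomial (mon i j) 1 : P2 K) = X 0 ^ i * X 1 ^ j := by
  rw [← pow_mon0, ← pow_mon1, monomial_mul, mul_one]
  congr 1
  ext x
  simp [mon]

open MvPolynomial in
noncomputable def mo (K : Type) [Field K] (a m : ℕ) : Hg K a :=
  if h : m ≤ a then ⟨X 0 ^ m * X 1 ^ (a - m), by
    have := hg_monomial (K := K) m (a - m) 1
    rwa [Nat.add_sub_cancel' h, mon_pow] at this⟩ else 0

open MvPolynomial in
lemma mo_val {a m : ℕ} (h : m ≤ a) : (mo K a m).1 = X 0 ^ m * X 1 ^ (a - m) := by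
  rw [mo, dif_pos h]

noncomputable def hb (K : Type) [Field K] (a : ℕ) : Module.Basis (Fin (a+1)) K (Hg K a) :=
  Module.Basis.ofEquivFun (hgEquiv K a)

lemma hb_apply (a : ℕ) (i : Fin (a+1)) : hb K a i = mo K a i := by
  rw [hb, Module.Basis.coe_ofEquivFun]
  apply Subtype.ext
  rw [mo_val (by omega), ← mon_pow]
  change ∑ j : Fin (a + 1), MvPolynomial.monomial (mon j (a - j)) ((Function.update (0 : Fin (a+1) → K) i 1) j) = _
  rw [Finset.sum_eq_single i]
  · simp
  · intro b _ hb
    simp [hb]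
  · simp

noncomputable def eL (K : Type) [Field K] (a j : ℕ) : Hg K a →ₗ[K] Hg K a :=
  (hb K a).constr K fun i => ((a - i).choose j : K) • mo K a (i + j)

noncomputable def fL (K : Type) [Field K] (a j : ℕ) : Hg K a →ₗ[K] Hg K a :=
  (hb K a).constr K fun i => ((i : ℕ).choose j : K) • mo K a (i - j)

lemma eL_hb (a j : ℕ) (i : Fin (a+1)) : eL K a j (hb K a i) = ((a - i).choose j : K) • mo K a (i + j) := by
  rw [eL, Module.Basis.constr_basis]

lemma fL_hb (a j : ℕ) (i : Fin (a+1)) : fL K a j (hb K a i) = ((i : ℕ).choose j : K) • mo K a (i - j) := by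
  rw [fL, Module.Basis.constr_basis]

lemma ext_range {V : Type} [AddCommGroup V] (f : ℕ → V) {m p : ℕ} (h : m ≤ p)
    (hf : ∀ j, m ≤ j → f j = 0) : ∑ j ∈ Finset.range p, f j = ∑ j ∈ Finset.range m, f j := by
  symm
  apply Finset.sum_subset
  · intro x; simp; omega
  · intro x _ hx
    exact hf x (by simpa using hx)

open MvPolynomial in
lemma syA_e (A : SL2 K) (s : K) (h00 : A.1 0 0 = 1) (h10 : A.1 1 0 = 0) (h01 : A.1 0 1 = s)
    (h11 : A.1 1 1 = 1) (a p : ℕ) (hp : a < p) :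
    syA A a = ∑ j ∈ Finset.range p, s ^ j • eL K a j := by
  refine (hb K a).ext fun i => ?_
  have hi : (i : ℕ) ≤ a := by omega
  simp only [LinearMap.sum_apply, LinearMap.smul_apply, eL_hb]
  rw [ext_range (m := a - i + 1) _ (by omega) (by
    intro j hj; rw [Nat.choose_eq_zero_of_lt (by omega)]; simp)]
  apply Subtype.ext
  rw [syA_val, hb_apply, mo_val hi, map_mul, map_pow, map_pow, sub_X, sub_X, h00, h10, h01, h11]
  simp only [one_smul, zero_smul, add_zero]
  rw [add_pow, Finset.mul_sum, AddSubmonoidClass.coe_finset_sum]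
  refine Finset.sum_congr rfl fun j hj => ?_
  have hj : j ≤ a - i := by simp at hj; omega
  rw [Submodule.coe_smul, Submodule.coe_smul, mo_val (by omega), smul_pow, smul_smul,
    show a - (i + j) = a - i - j by omega, pow_add]
  simp only [smul_eq_C_mul, map_mul, map_pow, map_natCast]
  ring

open MvPolynomial in
lemma syA_f (A : SL2 K) (s : K) (h00 : A.1 0 0 = 1) (h10 : A.1 1 0 = s) (h01 : A.1 0 1 = 0)
    (h11 : A.1 1 1 = 1) (a p : ℕ) (hp : a < p) :
    syA A a = ∑ j ∈ Finset.range p, s ^ j • fL K a j := by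
  refine (hb K a).ext fun i => ?_
  have hi : (i : ℕ) ≤ a := by omega
  simp only [LinearMap.sum_apply, LinearMap.smul_apply, fL_hb]
  rw [ext_range (m := i + 1) _ (by omega) (by
    intro j hj; rw [Nat.choose_eq_zero_of_lt (by omega)]; simp)]
  apply Subtype.ext
  rw [syA_val, hb_apply, mo_val hi, map_mul, map_pow, map_pow, sub_X, sub_X, h00, h10, h01, h11]
  simp only [one_smul, zero_smul, zero_add]
  rw [add_comm, add_pow, Finset.sum_mul, AddSubmonoidClass.coe_finset_sum]
  refine Finset.sum_congr rfl fun j hj => ?_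
  have hj : j ≤ i := by simp at hj; omega
  rw [Submodule.coe_smul, Submodule.coe_smul, mo_val (by omega), smul_pow, smul_smul,
    show a - (i - j) = a - i + j by omega, pow_add]
  simp only [smul_eq_C_mul, map_mul, map_pow, map_natCast]
  ring

lemma eL_top (a : ℕ) (i : Fin (a+1)) : eL K a (a - i) (hb K a i) = mo K a a := by
  rw [eL_hb, Nat.choose_self, Nat.add_sub_cancel' (by omega)]; simp

lemma eL_gt (a : ℕ) (i j : Fin (a+1)) (h : i < j) : eL K a (a - i) (hb K a j) = 0 := by
  rw [eL_hb, Nat.choose_eq_zero_of_lt (by have : (i : ℕ) < j := h; omega)]; simp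

lemma fL_top (a j : ℕ) : fL K a j (mo K a a) = (a.choose j : K) • mo K a (a - j) := by
  have := fL_hb (K := K) a j (Fin.last a)
  rwa [hb_apply] at this

/-- data expressing the action of root subgroups -/
def Dat {T : Type} (u l : T → G) (θ : T → K) (X : Rp K G) (N : ℕ) : Prop :=
  ∃ (E F : Fin N → X.V →ₗ[K] X.V) (v : X.V), v ≠ 0 ∧
    (∀ t, X.ρ (u t) = ∑ i : Fin N, θ t ^ (i : ℕ) • E i) ∧
    (∀ t, X.ρ (l t) = ∑ i : Fin N, θ t ^ (i : ℕ) • F i) ∧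
    (∀ w, w ≠ 0 → ∃ i, ∃ c : K, c ≠ 0 ∧ E i w = c • v) ∧
    Submodule.span K (Set.range fun i => F i v) = ⊤

lemma Dat.unit {T : Type} (u l : T → G) (θ : T → K) : Dat u l θ (Rp.unit K G) 1 := by
  refine ⟨fun _ => LinearMap.id, fun _ => LinearMap.id, (1 : K), one_ne_zero, ?_, ?_, ?_, ?_⟩
  · intro t; ext; simp
  · intro t; ext; simp
  · intro w hw; exact ⟨0, w, hw, by simp⟩
  · simp

lemma sum_tprod {T : Type} {V W : Type} [AddCommGroup V] [Module K V] [AddCommGroup W] [Module K W]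
    (N p : ℕ) (s : K) (E : Fin N → V →ₗ[K] V) (e : ℕ → W →ₗ[K] W) :
    TensorProduct.map (∑ i : Fin N, s ^ (i : ℕ) • E i) (∑ j ∈ Finset.range p, (s ^ N) ^ j • e j) =
      ∑ x : Fin (p * N), s ^ (x : ℕ) • TensorProduct.map (E (finProdFinEquiv.symm x).2)
        (e (finProdFinEquiv.symm x).1) := by
  rw [← finProdFinEquiv.sum_comp, Fintype.sum_prod_type_right]
  refine TensorProduct.ext' fun v w => ?_
  simp only [TensorProduct.map_tmul, LinearMap.sum_apply, LinearMap.smul_apply, Equiv.symm_apply_apply,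
    finProdFinEquiv_apply_val]
  rw [TensorProduct.sum_tmul]
  refine Finset.sum_congr rfl fun i _ => ?_
  rw [Finset.sum_range, TensorProduct.tmul_sum]
  refine Finset.sum_congr rfl fun j _ => ?_
  rw [TensorProduct.tmul_smul, TensorProduct.smul_tmul', smul_smul, pow_add, pow_mul, mul_comm,
    TensorProduct.smul_tmul']

lemma Dat.step {T : Type} {u l : T → G} {θ : T → K} {X : Rp K G} {N : ℕ} (h : Dat u l θ X N)
    (γ : G →* SL2 K) (a p : ℕ) (hp : a < p) (hlt : ∀ j ≤ a, (a.choose j : K) ≠ 0)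
    (hu : ∀ t, (γ (u t)).1 0 0 = 1 ∧ (γ (u t)).1 1 0 = 0 ∧ (γ (u t)).1 0 1 = θ t ^ N ∧ (γ (u t)).1 1 1 = 1)
    (hl : ∀ t, (γ (l t)).1 0 0 = 1 ∧ (γ (l t)).1 1 0 = θ t ^ N ∧ (γ (l t)).1 0 1 = 0 ∧ (γ (l t)).1 1 1 = 1) :
    Dat u l θ (X.tensor (Sy γ a)) (p * N) := by
  classical
  obtain ⟨E, F, v, hv, hE, hF, hA, hB⟩ := h
  refine ⟨fun x => TensorProduct.map (E (finProdFinEquiv.symm x).2) (eL K a (finProdFinEquiv.symm x).1),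
    fun x => TensorProduct.map (F (finProdFinEquiv.symm x).2) (fL K a (finProdFinEquiv.symm x).1),
    v ⊗ₜ mo K a a, ?_, ?_, ?_, ?_, ?_⟩
  · intro h0
    have h1 := congrArg (TensorProduct.rid K X.V) (congrArg (TensorProduct.map LinearMap.id ((hb K a).coord (Fin.last a))) h0)
    apply hv
    have h2 : (hb K a).coord (Fin.last a) (mo K a a) = 1 := by
      have := hb_apply (K := K) a (Fin.last a)
      rw [Fin.val_last] at this
      rw [← this]; simp
    rw [TensorProduct.map_tmul, h2] at h1
    simpa using h1
  · intro t
    obtain ⟨h1, h2, h3, h4⟩ := hu t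
    rw [← sum_tprod (T := T), ← hE, ← syA_e _ _ h1 h2 h3 h4 a p hp]
    rfl
  · intro t
    obtain ⟨h1, h2, h3, h4⟩ := hl t
    rw [← sum_tprod (T := T), ← hF, ← syA_f _ _ h1 h2 h3 h4 a p hp]
    rfl
  · intro w hw
    obtain ⟨c, rfl⟩ := TensorProduct.eq_repr_basis_right (hb K a) w
    have hne : ∃ i, c i ≠ 0 := by
      by_contra! hc
      apply hw
      simp [Finsupp.sum, hc]
    let s : Finset (Fin (a+1)) := {i | c i ≠ 0}
    have hs : s.Nonempty := by
      obtain ⟨i, hi⟩ := hne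
      exact ⟨i, by simp [s, hi]⟩
    let i := s.min' hs
    have hi : c i ≠ 0 := by
      have := s.min'_mem hs
      simpa [s] using this
    have hlti : ∀ j, j < i → c j = 0 := by
      intro j hj
      by_contra hc
      have := s.min'_le j (by simp [s, hc])
      exact absurd hj (not_lt.2 this)
    obtain ⟨j, d, hd, hj⟩ := hA (c i) hi
    refine ⟨finProdFinEquiv (⟨a - i, by omega⟩, j), d, hd, ?_⟩
    simp only [Equiv.symm_apply_apply]
    rw [Finsupp.sum, map_sum, Finset.sum_eq_single i]
    · rw [TensorProduct.map_tmul, eL_top, hj, TensorProduct.smul_tmul']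
    · intro b _ hbi
      rcases lt_or_gt_of_ne hbi with h | h
      · rw [hlti b h]; simp
      · rw [TensorProduct.map_tmul, eL_gt a i b h]; simp
    · intro h
      have : c i = 0 := by simpa using h
      exact absurd this hi
  · rw [eq_top_iff]
    set W := Submodule.span K (Set.range fun x : Fin (p * N) => TensorProduct.map (F (finProdFinEquiv.symm x).2) (fL K a (finProdFinEquiv.symm x).1) (v ⊗ₜ mo K a a)) with hW
    have key : ∀ (x : X.V) (i : Fin (a+1)), x ⊗ₜ[K] hb K a i ∈ W := by
      intro x i
      have hx : x ∈ Submodule.span K (Set.range fun i => F i v) := by rw [hB]; trivial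
      induction hx using Submodule.span_induction with
      | mem x hx =>
        obtain ⟨j, rfl⟩ := hx
        have h1 : TensorProduct.map (F j) (fL K a (a - i)) (v ⊗ₜ mo K a a) ∈ W :=
          Submodule.subset_span ⟨finProdFinEquiv (⟨a - i, by omega⟩, j), by simp⟩
        rw [TensorProduct.map_tmul, fL_top, Nat.sub_sub_self (by omega), TensorProduct.tmul_smul] at h1
        rw [hb_apply]
        exact (Submodule.smul_mem_iff _ (hlt _ (by omega))).1 h1
      | zero => simp
      | add x y _ _ hx hy => rw [TensorProduct.add_tmul]; exact add_mem hx hy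
      | smul r x _ hx => rw [← TensorProduct.smul_tmul']; exact W.smul_mem _ hx
    intro w _
    obtain ⟨c, rfl⟩ := TensorProduct.eq_repr_basis_right (hb K a) w
    exact Submodule.sum_mem _ fun i _ => key _ i

def Irr (X : Rp K G) : Prop :=
  Nontrivial X.V ∧ ∀ W : Submodule K X.V, (∀ g, ∀ w ∈ W, X.ρ g w ∈ W) → W = ⊥ ∨ W = ⊤

lemma extract {T : Type} [Fintype T] {θ : T → K} (hθ : Function.Injective θ)
    {V : Type} [AddCommGroup V] [Module K V] (N : ℕ) (hN : N ≤ Fintype.card T) (x : Fin N → V)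
    (W : Submodule K V) (h : ∀ t, ∑ i : Fin N, θ t ^ (i : ℕ) • x i ∈ W) (i : Fin N) : x i ∈ W := by
  by_contra hc
  obtain ⟨f, hf, hf0⟩ := Submodule.exists_le_ker_of_notMem hc
  let P : Polynomial K := ∑ i : Fin N, Polynomial.monomial i (f (x i))
  have hP : P = 0 := by
    refine Polynomial.eq_zero_of_natDegree_lt_card_of_eval_eq_zero P hθ ?_ ?_
    · intro t
      have := hf0 (h t)
      rw [LinearMap.mem_ker] at this
      simpa [P, Polynomial.eval_finset_sum, mul_comm] using this
    · refine lt_of_lt_of_le ?_ hN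
      have h0 : 0 < N := i.pos
      refine lt_of_le_of_lt (Polynomial.natDegree_sum_le_of_forall_le (n := N - 1) _ _ ?_) (by omega)
      intro j _
      exact (Polynomial.natDegree_monomial_le _).trans (by omega)
  apply hf
  have : P.coeff i = f (x i) := by
    simp [P, Polynomial.finset_sum_coeff, Polynomial.coeff_monomial, Fin.val_inj]
  rw [← this, hP]; simp

lemma Dat.irr {T : Type} [Fintype T] {u l : T → G} {θ : T → K} (hθ : Function.Injective θ)
    {X : Rp K G} {N : ℕ} (h : Dat u l θ X N) (hN : N ≤ Fintype.card T) : Irr X := by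
  obtain ⟨E, F, v, hv, hE, hF, hA, hB⟩ := h
  refine ⟨⟨v, 0, hv⟩, fun W hW => ?_⟩
  by_cases h0 : W = ⊥
  · exact Or.inl h0
  right
  obtain ⟨w, hw, hw0⟩ := (Submodule.ne_bot_iff W).1 h0
  obtain ⟨i, c, hc, hi⟩ := hA w hw0
  have h1 : E i w ∈ W := extract hθ N hN (fun i => E i w) W (fun t => by
    have := hW (u t) w hw
    rw [hE] at this
    simpa using this) i
  rw [hi, Submodule.smul_mem_iff _ hc] at h1
  rw [eq_top_iff, ← hB, Submodule.span_le]
  rintro _ ⟨i, rfl⟩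
  exact extract hθ N hN (fun i => F i v) W (fun t => by
    have := hW (l t) v h1
    rw [hF] at this
    simpa using this) i

end T4
end SLAlg

open CategoryTheory CategoryTheory.MonoidalCategory
open AlgebraicModule

namespace SLAlg
open Representation TensorProduct

section T6
variable {K : Type} [Field K]

lemma irr_cl {G : Type} [Group G] {X M : Rp K G} (hX : Irr X) (hM : Irr M) (h : Hit X M) : cl X = cl M := by
  obtain ⟨f, hf⟩ := h
  have hker := hX.2 (LinearMap.ker f.toLinearMap) (by
    intro g w hw
    rw [LinearMap.mem_ker] at *
    have := IntertwiningMap.isIntertwining _ _ f g w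
    change f (X.ρ g w) = 0
    rw [this]
    change f w = 0 at hw
    rw [hw, map_zero])
  have hran := hM.2 (LinearMap.range f.toLinearMap) (by
    rintro g _ ⟨w, rfl⟩
    exact ⟨X.ρ g w, IntertwiningMap.isIntertwining _ _ f g w⟩)
  have hinj : Function.Injective f := by
    rcases hker with h | h
    · exact LinearMap.ker_eq_bot.1 h
    · exact absurd (DFunLike.ext f 0 fun x => by
        have : x ∈ LinearMap.ker f.toLinearMap := by rw [h]; trivial
        exact this) hf
  have hsurj : Function.Surjective f := by
    rcases hran with h | h
    · exact absurd (DFunLike.ext f 0 fun x => by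
        have : f x ∈ LinearMap.range f.toLinearMap := ⟨x, rfl⟩
        rw [h] at this
        exact this) hf
    · exact LinearMap.range_eq_top.1 h
  exact equiv_of_inj f hinj (LinearEquiv.finrank_eq (LinearEquiv.ofBijective f.toLinearMap ⟨hinj, hsurj⟩))

variable {F : Type} [Field F] [Finite F] (c : ℕ) [Fact (c+2).Prime] [CharP K (c+2)] (θ : F →+* K)

noncomputable def gam (k : ℕ) : SL2 F →* SL2 K :=
  Matrix.SpecialLinearGroup.map ((iterateFrobenius K (c+2) k).comp θ)

lemma gam_apply (k : ℕ) (g : SL2 F) (i j : Fin 2) : (gam c θ k g).1 i j = θ (g.1 i j) ^ ((c+2) ^ k) := by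
  change (iterateFrobenius K (c+2) k) (θ (g.1 i j)) = _
  rw [iterateFrobenius_def]

noncomputable def LL (m : ℕ → ℕ) : ℕ → Rp K (SL2 F)
  | 0 => Rp.unit K _
  | k + 1 => (LL m k).tensor (Sy (gam c θ k) (m k))

lemma cl_LL (m : ℕ → ℕ) (k : ℕ) : cl (LL c θ m k) = ∏ i ∈ Finset.range k, cl (Sy (gam c θ i) (m i)) := by
  induction k with
  | zero => rw [LL, cl_unit, Finset.prod_range_zero]
  | succ k ih => rw [LL, cl_tensor, ih, Finset.prod_range_succ]

def uF (t : F) : SL2 F := ⟨!![1, t; 0, 1], by simp⟩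
def lF (t : F) : SL2 F := ⟨!![1, 0; t, 1], by simp⟩

lemma choose_ne (a j : ℕ) (ha : a < c + 2) (hj : j ≤ a) : (a.choose j : K) ≠ 0 := by
  rw [Ne, CharP.cast_eq_zero_iff K (c+2)]
  intro h
  have hp : (c+2).Prime := Fact.out
  have : (c + 2) ∣ a.factorial := by
    rw [← Nat.choose_mul_factorial_mul_factorial hj]
    exact Dvd.dvd.mul_right (Dvd.dvd.mul_right h _) _
  have := (hp.dvd_factorial).1 this
  omega

lemma dat_LL (m : ℕ → ℕ) (hm : ∀ i, m i ≤ c + 1) (k : ℕ) :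
    Dat uF lF θ (LL c θ m k) ((c+2)^k) := by
  induction k with
  | zero => exact Dat.unit _ _ _
  | succ k ih =>
    rw [pow_succ']
    refine Dat.step ih (gam c θ k) (m k) (c+2) (by have := hm k; omega)
      (fun j hj => choose_ne c _ _ (by have := hm k; omega) hj) ?_ ?_
    · intro t
      rw [gam_apply, gam_apply, gam_apply, gam_apply]; simp [uF]
    · intro t
      rw [gam_apply, gam_apply, gam_apply, gam_apply]; simp [lF]

lemma irr_LL (m : ℕ → ℕ) (hm : ∀ i, m i ≤ c + 1) (n : ℕ) (hn : Nat.card F = (c+2)^n) :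
    Irr (LL c θ m n) := by
  have := Fintype.ofFinite F
  refine Dat.irr θ.injective (dat_LL c θ m hm n) ?_
  rw [← Nat.card_eq_fintype_card, hn]

noncomputable def del (n : ℕ) (i : Fin n) : SL2 F →* SL2 K := gam c θ i

variable (n : ℕ) [NeZero n] (hn : Nat.card F = (c+2)^n)
lemma del_succ (hn : Nat.card F = (c+2)^n) (i : Fin n) (g : SL2 F) (a b : Fin 2) :
    (del c θ n (i+1) g).1 a b = (del c θ n i g).1 a b ^ (c+2) := by
  rw [del, del, gam_apply, gam_apply, ← pow_mul, ← pow_succ]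
  have := Fintype.ofFinite F
  have h1 : (i : ℕ) + 1 ≤ n := i.2
  have hv : ((i + 1 : Fin n) : ℕ) = ((i : ℕ) + 1) % n := by
    rw [Fin.val_add, Fin.val_one', Nat.add_mod_mod]
  rcases h1.lt_or_eq with h | h
  · rw [hv, Nat.mod_eq_of_lt h]
  · rw [hv, h, Nat.mod_self, ← hn, Nat.card_eq_fintype_card, pow_zero, pow_one, ← map_pow,
      FiniteField.pow_card]

theorem classM (hn : Nat.card F = (c+2)^n) (M : Rp K (SL2 F)) (hM : Irr M) :
    ∃ a, CAdd (cl M) {vv (del c θ n) a} := by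
  obtain ⟨⟨m, hm⟩, -⟩ := id hM
  have hm : ∃ m : M.V, m ≠ 0 := by
    have := hM.1
    exact exists_ne 0
  obtain ⟨m, hm⟩ := hm
  have hinj : Function.Injective (del c θ n 0) := by
    intro g h hgh
    ext i j
    have : (del c θ n 0 g).1 i j = (del c θ n 0 h).1 i j := by rw [hgh]
    rw [del, gam_apply, gam_apply] at this
    simp only [Fin.val_zero, pow_zero, pow_one] at this
    exact θ.injective this
  obtain ⟨r, hr⟩ := T5 (del c θ n 0) hinj M m hm
  rw [← vv_single] at hr
  obtain ⟨a, ha, X, hX, hit⟩ := classify c (del c θ n) (del_succ c θ n hn) M _ _ rfl hr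
  let m' : ℕ → ℕ := fun i => if h : i < n then a ⟨i, h⟩ else 0
  have hm' : ∀ i, m' i ≤ c + 1 := by
    intro i
    simp only [m']
    split_ifs
    · exact ha _
    · omega
  have hL : cl (LL c θ m' n) = ∏ i, cl (Sy (del c θ n i) (a i)) := by
    rw [cl_LL, ← Fin.prod_univ_eq_prod_range]
    refine Finset.prod_congr rfl fun i _ => ?_
    simp [m', del]
  have := irr_cl (irr_LL c θ m' hm' n hn) hM (hit.of_cl (hX.trans hL.symm))
  refine ⟨a, ?_⟩
  rw [← this, hL]
  exact prodS_ret c _ a ha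

end T6
end SLAlg

open CategoryTheory CategoryTheory.MonoidalCategory
open AlgebraicModule

namespace SLAlg
open Representation TensorProduct

section compl
variable {k G : Type} [Field k] [Group G]

lemma compl_k {V : Type} [AddCommGroup V] [Module k V] [Module.Finite k V] (σ : Representation k G V)
    (M : Rp k G) (hM : Irr M) (ι : Type) (j : ι → M.V →ₗ[k] V) (hj : ∀ i g x, j i (M.ρ g x) = σ g (j i x))
    (hs : ∀ U : Submodule k V, (∀ i x, j i x ∈ U) → U = ⊤)
    (W : Submodule k V) (hW : ∀ g, ∀ w ∈ W, σ g w ∈ W) :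
    ∃ U : Submodule k V, (∀ g, ∀ w ∈ U, σ g w ∈ U) ∧ IsCompl W U := by
  let S : Set (Submodule k V) := {U | (∀ g, ∀ w ∈ U, σ g w ∈ U) ∧ Disjoint W U}
  have hne : S.Nonempty := ⟨⊥, by
    refine ⟨?_, disjoint_bot_right⟩
    intro g w hw
    rw [Submodule.mem_bot] at *
    rw [hw, map_zero]⟩
  obtain ⟨U, hU, hmax⟩ := (wellFounded_gt (α := Submodule k V)).has_min S hne
  refine ⟨U, hU.1, hU.2, ?_⟩
  rw [codisjoint_iff]
  apply hs
  intro i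
  have hst : ∀ g, ∀ w ∈ W ⊔ U, σ g w ∈ W ⊔ U := by
    intro g w hw
    obtain ⟨a, ha, b, hb, rfl⟩ := Submodule.mem_sup.1 hw
    rw [map_add]
    exact add_mem (Submodule.mem_sup_left (hW g a ha)) (Submodule.mem_sup_right (hU.1 g b hb))
  rcases hM.2 ((W ⊔ U).comap (j i)) (by
    intro g w hw
    rw [Submodule.mem_comap] at *
    rw [hj]; exact hst _ _ hw) with h | h
  · exfalso
    obtain ⟨x0, hx0⟩ : ∃ x : M.V, x ≠ 0 := by
      have := hM.1
      exact exists_ne 0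
    have hmem : U ⊔ LinearMap.range (j i) ∈ S := by
      refine ⟨?_, ?_⟩
      · intro g w hw
        obtain ⟨a, ha, b, ⟨y, rfl⟩, rfl⟩ := Submodule.mem_sup.1 hw
        rw [map_add, ← hj]
        exact add_mem (Submodule.mem_sup_left (hU.1 g a ha)) (Submodule.mem_sup_right ⟨_, rfl⟩)
      · rw [Submodule.disjoint_def]
        intro x hx hx'
        obtain ⟨a, ha, b, ⟨y, rfl⟩, rfl⟩ := Submodule.mem_sup.1 hx'
        have : y ∈ (W ⊔ U).comap (j i) := by
          rw [Submodule.mem_comap]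
          have h2 : j i y = (a + j i y) - a := by abel
          rw [h2]
          exact _root_.sub_mem (Submodule.mem_sup_left hx) (Submodule.mem_sup_right ha)
        rw [h, Submodule.mem_bot] at this
        subst this
        rw [map_zero, add_zero] at hx ⊢
        exact Submodule.disjoint_def.1 hU.2 a hx ha
    apply hmax _ hmem
    refine lt_of_le_of_ne le_sup_left fun he => hx0 ?_
    have h1 : x0 ∈ (W ⊔ U).comap (j i) := by
      rw [Submodule.mem_comap]
      apply Submodule.mem_sup_right
      rw [he]
      exact Submodule.mem_sup_right ⟨x0, rfl⟩
    rwa [h, Submodule.mem_bot] at h1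
  · intro x
    have : x ∈ (W ⊔ U).comap (j i) := by rw [h]; trivial
    exact this

lemma proj_k {V : Type} [AddCommGroup V] [Module k V] (σ : Representation k G V)
    (W U : Submodule k V) (hW : ∀ g, ∀ w ∈ W, σ g w ∈ W) (hU : ∀ g, ∀ w ∈ U, σ g w ∈ U)
    (h : IsCompl W U) :
    ∃ π : V →ₗ[k] V, (∀ x, π x ∈ W) ∧ (∀ x ∈ W, π x = x) ∧ ∀ g x, π (σ g x) = σ g (π x) := by
  have h1 : ∀ x ∈ W, W.subtype (Submodule.projectionOnto W U h x) = x := fun x hx => by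
    have := Submodule.projectionOnto_apply_left h ⟨x, hx⟩
    rw [this]; rfl
  have h2 : ∀ x ∈ U, W.subtype (Submodule.projectionOnto W U h x) = 0 := fun x hx => by
    have := Submodule.projectionOnto_apply_right h ⟨x, hx⟩
    rw [this]; rfl
  refine ⟨W.subtype ∘ₗ Submodule.projectionOnto W U h, fun x => Submodule.coe_mem _, h1, ?_⟩
  intro g x
  have hx : x ∈ W ⊔ U := by rw [h.sup_eq_top]; trivial
  obtain ⟨a, ha, b, hb, rfl⟩ := Submodule.mem_sup.1 hx
  simp only [LinearMap.comp_apply, map_add]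
  rw [h1 a ha, h2 b hb, h1 _ (hW g a ha), h2 _ (hU g b hb), map_zero]

end compl

section bc
variable {k G : Type} [Field k] [Group G] (K : Type) [Field K] [Algebra k K]

noncomputable def bcRep (M : Rp k G) : Representation K G (K ⊗[k] M.V) where
  toFun g := (M.ρ g).baseChange K
  map_one' := by
    refine TensorProduct.AlgebraTensorModule.ext fun a m => ?_
    simp
  map_mul' g h := by
    refine TensorProduct.AlgebraTensorModule.ext fun a m => ?_
    simp

noncomputable abbrev Rp.bc (M : Rp k G) : Rp K G := ⟨K ⊗[k] M.V, bcRep K M⟩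

lemma bc_tmul (M : Rp k G) (g : G) (a : K) (m : M.V) : (M.bc K).ρ g (a ⊗ₜ m) = a ⊗ₜ M.ρ g m := rfl

variable [FiniteDimensional k K]

lemma exists_proj [Algebra.FormallyUnramified k K] (M : Rp k G) (hM : Irr M)
    (W : Submodule K (K ⊗[k] M.V)) (hW : ∀ g, ∀ w ∈ W, (M.bc K).ρ g w ∈ W) :
    ∃ e : Hm (M.bc K) (M.bc K), (∀ x, e x ∈ W) ∧ ∀ x ∈ W, e x = x := by
  let σ : Representation k G (K ⊗[k] M.V) :=
    { toFun := fun g => ((M.bc K).ρ g).restrictScalars k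
      map_one' := by ext; simp
      map_mul' := fun g h => by ext; simp }
  have hσ : ∀ g x, σ g x = (M.bc K).ρ g x := fun _ _ => rfl
  obtain ⟨U, hU, hc⟩ := compl_k σ M hM K (fun a => TensorProduct.mk k K M.V a) (fun a g x => rfl) (by
    intro U hU
    rw [eq_top_iff, ← TensorProduct.span_tmul_eq_top, Submodule.span_le]
    rintro _ ⟨a, m, rfl⟩
    exact hU a m) (W.restrictScalars k) hW
  obtain ⟨π, h1, h2, h3⟩ := proj_k σ _ U hW hU hc
  obtain ⟨S, hS⟩ := TensorProduct.exists_finset (Algebra.FormallyUnramified.elem k K)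
  let T : (x : K ⊗[k] M.V) → K ⊗[k] K →ₗ[k] K ⊗[k] M.V := fun x =>
    TensorProduct.lift (LinearMap.mk₂ k (fun a b => a • π (b • x))
      (fun a a' b => add_smul _ _ _) (fun c a b => smul_assoc _ _ _)
      (fun a b b' => by rw [add_smul, map_add, smul_add])
      (fun c a b => by rw [smul_assoc, map_smul, smul_comm]))
  have hT : ∀ x a b, T x (a ⊗ₜ b) = a • π (b • x) := fun x a b => rfl
  let f : K ⊗[k] M.V → K ⊗[k] M.V := fun x => T x (Algebra.FormallyUnramified.elem k K)
  have hf : ∀ x, f x = ∑ i ∈ S, i.1 • π (i.2 • x) := by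
    intro x
    simp only [f]
    rw [hS, map_sum]
    rfl
  refine ⟨⟨⟨⟨f, ?_⟩, ?_⟩, ?_⟩, ?_, ?_⟩
  · intro x y
    rw [hf, hf, hf, ← Finset.sum_add_distrib]
    refine Finset.sum_congr rfl fun i _ => ?_
    rw [smul_add, map_add, smul_add]
  · intro c x
    change f (c • x) = c • f x
    have e1 : f (c • x) = T x ((1 ⊗ₜ c) * Algebra.FormallyUnramified.elem k K) := by
      rw [hf, hS, Finset.mul_sum, map_sum]
      refine Finset.sum_congr rfl fun i _ => ?_
      rw [Algebra.TensorProduct.tmul_mul_tmul, hT, one_mul, mul_comm, mul_smul]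
    have e2 : c • f x = T x ((c ⊗ₜ 1) * Algebra.FormallyUnramified.elem k K) := by
      rw [hf, hS, Finset.mul_sum, map_sum, Finset.smul_sum]
      refine Finset.sum_congr rfl fun i _ => ?_
      rw [Algebra.TensorProduct.tmul_mul_tmul, hT, one_mul, mul_smul]
    rw [e1, e2, Algebra.FormallyUnramified.one_tmul_mul_elem]
  · intro g
    refine LinearMap.ext fun x => ?_
    change f ((M.bc K).ρ g x) = (M.bc K).ρ g (f x)
    rw [hf, hf, map_sum]
    refine Finset.sum_congr rfl fun i _ => ?_
    rw [((M.bc K).ρ g).map_smul, ← hσ g (π _), ← h3, hσ, ((M.bc K).ρ g).map_smul]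
  · intro x
    change f x ∈ W
    rw [hf]
    exact Submodule.sum_mem _ fun i _ => W.smul_mem _ (h1 _)
  · intro x hx
    change f x = x
    have := Algebra.FormallyUnramified.lmul_elem (R := k) (S := K)
    rw [hS, map_sum] at this
    rw [hf]
    conv_rhs => rw [← one_smul K x, ← this, Finset.sum_smul]
    refine Finset.sum_congr rfl fun i _ => ?_
    rw [h2 _ (W.smul_mem _ hx), Algebra.TensorProduct.lmul'_apply_tmul, mul_smul]

end bc

section ss
variable {K G : Type} [Field K] [Group G]

lemma exists_irr (X : Rp K G) (W : Subrepresentation X.ρ) (hW : W.toSubmodule ≠ ⊥) :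
    ∃ S : Subrepresentation X.ρ, S.toSubmodule ≤ W.toSubmodule ∧ S.toSubmodule ≠ ⊥ ∧ Irr (X.sub S) := by
  let A : Set (Submodule K X.V) := {S | (∀ g, ∀ w ∈ S, X.ρ g w ∈ S) ∧ S ≤ W.toSubmodule ∧ S ≠ ⊥}
  have hne : A.Nonempty := ⟨W.toSubmodule, fun g w hw => W.apply_mem_toSubmodule g hw, le_rfl, hW⟩
  obtain ⟨S, hS, hmin⟩ := (wellFounded_lt (α := Submodule K X.V)).has_min A hne
  refine ⟨⟨S, fun g w hw => hS.1 g w hw⟩, hS.2.1, hS.2.2, ?_, ?_⟩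
  · exact (Submodule.nontrivial_iff_ne_bot).2 hS.2.2
  · intro U hU
    by_cases h : U = ⊥
    · exact Or.inl h
    right
    by_contra h2
    refine hmin (U.map S.subtype) ⟨?_, ?_, ?_⟩ ?_
    · rintro g _ ⟨w, hw, rfl⟩
      exact ⟨_, hU g w hw, rfl⟩
    · exact (Submodule.map_subtype_le _ _).trans hS.2.1
    · intro h3
      exact h (Submodule.map_injective_of_injective S.subtype_injective (by rw [h3, Submodule.map_bot]))
    · refine lt_of_le_of_ne (Submodule.map_subtype_le _ _) fun h3 => h2 ?_
      exact Submodule.map_injective_of_injective S.subtype_injective (by rw [h3, Submodule.map_subtype_top])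

lemma ss_add (X : Rp K G)
    (hX : ∀ W : Submodule K X.V, (∀ g, ∀ w ∈ W, X.ρ g w ∈ W) →
      ∃ e : Hm X X, (∀ x, e x ∈ W) ∧ ∀ x ∈ W, e x = x) (n : ℕ) :
    ∀ W : Subrepresentation X.ρ, Module.finrank K W.toSubmodule = n → InAdd (X.sub W) {Y | Irr Y} := by
  induction n using Nat.strong_induction_on with
  | _ n ih =>
  intro W hn
  by_cases h0 : W.toSubmodule = ⊥
  · have : IntertwiningMap.id (X.sub W).ρ = 0 := by
      refine DFunLike.ext _ _ fun x => ?_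
      apply Subtype.ext
      exact (Submodule.mem_bot K).1 (h0 ▸ x.2 : _)
    rw [InAdd, this]
    exact zero_mem _
  obtain ⟨S, hSW, hS0, hS⟩ := exists_irr X W h0
  obtain ⟨e, he, he'⟩ := hX S.toSubmodule (fun g w hw => S.apply_mem_toSubmodule g hw)
  let W' : Subrepresentation X.ρ := ⟨W.toSubmodule ⊓ LinearMap.ker e.toLinearMap, by
    rintro g w ⟨h1, h2⟩
    refine ⟨W.apply_mem_toSubmodule g h1, ?_⟩
    change e w = 0 at h2
    change e (X.ρ g w) = 0
    rw [IntertwiningMap.isIntertwining _ _ e g w, h2, map_zero]⟩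
  have hW'W : W'.toSubmodule ≤ W.toSubmodule := inf_le_left
  have hlt : Module.finrank K W'.toSubmodule < n := by
    rw [← hn]
    apply Submodule.finrank_lt_finrank_of_lt
    refine lt_of_le_of_ne hW'W fun h => hS0 ?_
    rw [eq_bot_iff]
    intro x hx
    have : x ∈ W'.toSubmodule := by rw [h]; exact hSW hx
    have h2 : e x = 0 := this.2
    rw [he' x hx] at h2
    exact h2
  have key : InAdd (X.sub W) {X.sub S, X.sub W'} := by
    let f1 : Hm (X.sub W) (X.sub S) := subCod S (e.comp (subIncl X W)) fun v => he _
    let g1 : Hm (X.sub S) (X.sub W) := subCod W (subIncl X S) fun v => hSW v.2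
    let d : Hm (X.sub W) X := subIncl X W - e.comp (subIncl X W)
    have hd : ∀ v : W.toSubmodule, d v = v.1 - e v.1 := fun v => rfl
    let f2 : Hm (X.sub W) (X.sub W') := subCod W' d fun v => by
      rw [hd]
      refine ⟨_root_.sub_mem v.2 (hSW (he _)), ?_⟩
      change e (v.1 - e v.1) = 0
      rw [map_sub, he' _ (he _), sub_self]
    let g2 : Hm (X.sub W') (X.sub W) := subCod W (subIncl X W') fun v => hW'W v.2
    have : IntertwiningMap.id (X.sub W).ρ = g1.comp f1 + g2.comp f2 := by
      refine DFunLike.ext _ _ fun x => ?_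
      apply Subtype.ext
      change x.1 = e x.1 + (x.1 - e x.1)
      abel
    rw [InAdd, this]
    exact add_mem (mem_thr (by simp) f1 g1) (mem_thr (by simp) f2 g2)
  refine key.trans ?_
  rintro Y (rfl | rfl)
  · exact .of_mem hS
  · exact ih _ hlt W' rfl

lemma ss_add' (X : Rp K G)
    (hX : ∀ W : Submodule K X.V, (∀ g, ∀ w ∈ W, X.ρ g w ∈ W) →
      ∃ e : Hm X X, (∀ x, e x ∈ W) ∧ ∀ x ∈ W, e x = x) : InAdd X {Y | Irr Y} := by
  let W : Subrepresentation X.ρ := ⟨⊤, fun g w _ => trivial⟩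
  refine InAdd.trans (S := {X.sub W}) ?_ (by rintro _ rfl; exact ss_add X hX _ W rfl)
  exact InAdd.of_retract rfl (subCod W (IntertwiningMap.id _) fun v => trivial) (subIncl X W) fun v => rfl

end ss
end SLAlg

open CategoryTheory CategoryTheory.MonoidalCategory
open AlgebraicModule

namespace SLAlg
open Representation TensorProduct

section rs
variable (k : Type) {K G : Type} [Field k] [Field K] [Group G] [Algebra k K] [FiniteDimensional k K]

noncomputable abbrev rsMod (V : Type) [AddCommGroup V] [Module K V] : Module k V :=
  Module.compHom V (algebraMap k K)

lemma rsFin (V : Type) [AddCommGroup V] [Module K V] [Module.Finite K V] :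
    @Module.Finite k V _ _ (rsMod k (K := K) V) := by
  letI := rsMod k (K := K) V
  have : IsScalarTower k K V := ⟨fun a b x => by rw [Algebra.smul_def, mul_smul]; rfl⟩
  exact Module.Finite.trans K V

noncomputable def Rp.rs (X : Rp K G) : Rp k G :=
  letI := rsMod k (K := K) X.V
  { V := X.V
    mod := rsMod k (K := K) X.V
    fin := rsFin k X.V
    ρ :=
      { toFun := fun g =>
          { toFun := X.ρ g
            map_add' := map_add _
            map_smul' := fun c x => (X.ρ g).map_smul (algebraMap k K c) x }
        map_one' := by refine LinearMap.ext fun x => ?_; change X.ρ 1 x = x; simp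
        map_mul' := fun g h => by
          refine LinearMap.ext fun x => ?_
          change X.ρ (g * h) x = X.ρ g (X.ρ h x); simp } }

noncomputable def rsMap {X Y : Rp K G} (f : Hm X Y) : Hm (X.rs k) (Y.rs k) :=
  letI := rsMod k (K := K) X.V
  letI := rsMod k (K := K) Y.V
  ⟨{ toFun := fun x => f x
     map_add' := map_add f
     map_smul' := fun c x => f.toLinearMap.map_smul (algebraMap k K c) x }, fun g => by
    refine LinearMap.ext fun x => ?_
    exact IntertwiningMap.isIntertwining _ _ f g x⟩

lemma rs_thr {X : Rp K G} {S : Set (Rp K G)} {h : Hm X X} (hh : h ∈ thr X S) :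
    rsMap k h ∈ thr (X.rs k) ((fun Y => Rp.rs k Y) '' S) := by
  induction hh using AddSubmonoid.closure_induction with
  | mem h hh =>
    obtain ⟨Y, hY, f, g, rfl⟩ := hh
    exact mem_thr (Set.mem_image_of_mem (fun Y => Rp.rs k Y) hY) (rsMap k f) (rsMap k g)
  | zero => exact zero_mem _
  | add x y _ _ hx hy => exact add_mem hx hy

lemma InAdd.rs {X : Rp K G} {S : Set (Rp K G)} (h : InAdd X S) :
    InAdd (X.rs k) ((fun Y => Rp.rs k Y) '' S) := rs_thr k h

lemma inAdd_descend (N : Rp k G) {S : Set (Rp K G)} (h : InAdd (N.bc K) S) :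
    InAdd N ((fun Y => Rp.rs k Y) '' S) := by
  refine InAdd.trans (S := {(N.bc K).rs k}) ?_ (by rintro _ rfl; exact h.rs k)
  obtain ⟨lam, hlam⟩ : ∃ lam : K →ₗ[k] k, lam 1 = 1 := by
    obtain ⟨f, hf⟩ := Module.Projective.exists_dual_ne_zero k (one_ne_zero (α := K))
    exact ⟨(f 1)⁻¹ • f, by simp [hf]⟩
  have hsm : ∀ (c : k) (x : K ⊗[k] N.V), (algebraMap k K c) • x = c • x := fun c x => algebraMap_smul K c x
  let i : Hm N ((N.bc K).rs k) :=
    ⟨{ toFun := fun x => (1 : K) ⊗ₜ[k] x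
       map_add' := fun x y => TensorProduct.tmul_add _ _ _
       map_smul' := fun c x => by
        change _ = (algebraMap k K c) • ((1 : K) ⊗ₜ[k] x)
        rw [hsm, TensorProduct.tmul_smul] }, fun g => by
      refine LinearMap.ext fun x => ?_
      rfl⟩
  let r0 : K ⊗[k] N.V →ₗ[k] N.V := (TensorProduct.lid k N.V).toLinearMap ∘ₗ TensorProduct.map lam LinearMap.id
  let r : Hm ((N.bc K).rs k) N :=
    ⟨{ toFun := fun x => r0 x
       map_add' := fun x y => map_add r0 x y
       map_smul' := fun c x => by
        change r0 ((algebraMap k K c) • (show K ⊗[k] N.V from x)) = _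
        rw [hsm, map_smul]; rfl }, fun g => by
      refine LinearMap.ext fun x => ?_
      change r0 ((N.bc K).ρ g x) = N.ρ g (r0 x)
      change K ⊗[k] N.V at x
      induction x using TensorProduct.induction_on with
      | zero => simp
      | tmul a m => rw [bc_tmul]; simp [r0]
      | add x y hx hy => rw [map_add, map_add, hx, hy, map_add, map_add]⟩
  refine InAdd.of_retract rfl i r fun v => ?_
  change r0 ((1 : K) ⊗ₜ[k] v) = v
  simp [r0, hlam]

lemma cl_bc_tensor (X Y : Rp k G) : cl ((X.tensor Y).bc K) = cl (X.bc K) * cl (Y.bc K) := by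
  rw [← cl_tensor, cl_eq]
  refine ⟨Representation.Equiv.mk (TensorProduct.AlgebraTensorModule.distribBaseChange k K X.V Y.V) fun g => ?_⟩
  refine TensorProduct.AlgebraTensorModule.ext fun a m => ?_
  induction m using TensorProduct.induction_on with
  | zero => simp
  | tmul x y => rfl
  | add x y hx hy => rw [TensorProduct.tmul_add, map_add, map_add, hx, hy]

end rs

noncomputable def pw {k G : Type} [Field k] [Group G] (M : Rp k G) : ℕ → Rp k G
  | 0 => M
  | s + 1 => (pw M s).tensor M

section main
variable {k K F : Type} [Field k] [Field K] [Field F] [Algebra k K] [FiniteDimensional k K]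
  [Algebra.FormallyUnramified k K] [Finite F] (c : ℕ) [Fact (c+2).Prime] [CharP K (c+2)] (θ : F →+* K)
  (n : ℕ) [NeZero n]

lemma bc_cadd (hn : Nat.card F = (c+2)^n) (M : Rp k (SL2 F)) (hM : Irr M) :
    CAdd (cl (M.bc K)) {x | ∃ a, x = vv (del c θ n) a} := by
  apply CAdd.of_inAdd
  refine (ss_add' (M.bc K) (exists_proj K M hM)).trans fun Y hY => ?_
  obtain ⟨a, ha⟩ := classM c θ n hn Y hY
  refine (ha Y rfl).mono ?_
  intro Z hZ
  exact ⟨a, hZ⟩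

lemma bc_pw_cadd (hn : Nat.card F = (c+2)^n) (M : Rp k (SL2 F)) (hM : Irr M) (s : ℕ) :
    CAdd (cl ((pw M s).bc K)) {x | ∃ a, x = vv (del c θ n) a} := by
  induction s with
  | zero => exact bc_cadd c θ n hn M hM
  | succ s ih =>
    rw [pw, cl_bc_tensor]
    refine (ih.mul (bc_cadd c θ n hn M hM)).mono ?_
    rintro _ ⟨x, ⟨a, rfl⟩, y, ⟨b, rfl⟩, rfl⟩
    exact ⟨a + b, (vv_add _ _ _).symm⟩

theorem main_k (θ : F →+* K) (hn : Nat.card F = (c+2)^n) (M : Rp k (SL2 F)) (hM : Irr M) :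
    ∃ T : Set (Rp k (SL2 F)), T.Finite ∧ ∀ s, InAdd (pw M s) T := by
  choose R hR using fun m : Fin n → ℕ => cl_surj (vv (del c θ n) m)
  let B : Set (Fin n → ℕ) := {m | ∀ i, m i ≤ 2 * c + 2}
  have hB : B.Finite := by
    refine (Set.Finite.pi (t := fun _ : Fin n => Set.Iic (2*c+2)) fun _ => Set.finite_Iic _).subset ?_
    intro m hm i _
    exact hm i
  refine ⟨(fun Y => Rp.rs k Y) '' (R '' B), (hB.image _).image _, fun s => ?_⟩
  apply inAdd_descend
  have h1 : CAdd (cl ((pw M s).bc K)) {x | ∃ m', (∀ i, m' i ≤ 2*c+2) ∧ x = vv (del c θ n) m'} := by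
    refine (bc_pw_cadd c θ n hn M hM s).trans ?_
    rintro _ ⟨a, rfl⟩
    exact vv_bdd c (del c θ n) (del_succ c θ n hn) _ a rfl
  refine (h1 _ rfl).trans ?_
  rintro Y ⟨m, hm, hY⟩
  exact InAdd.of_cl (hY.trans (hR m).symm) (.of_mem ⟨m, hm, rfl⟩)

theorem main_list (θ : F →+* K) (hn : Nat.card F = (c+2)^n) (M : Rp k (SL2 F)) (hM : Irr M) :
    ∃ L : List (Rp k (SL2 F)), ∀ N, Ind N → (∃ s, Retr N (pw M s)) → ∃ N' ∈ L, Nonempty (N.ρ.Equiv N'.ρ) := by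
  obtain ⟨T, hT, h⟩ := main_k c n θ hn M hM
  obtain ⟨L, hL⟩ := ks_finite T hT
  exact ⟨L, fun N hN ⟨s, hs⟩ => hL N hN ⟨_, h s, hs⟩⟩
end main
end SLAlg

open CategoryTheory CategoryTheory.MonoidalCategory
open AlgebraicModule

namespace SLAlg
open Representation TensorProduct

section bridge
variable {k G : Type} [Field k] [Group G]

noncomputable abbrev toRp (X : FDRep k G) : Rp k G := ⟨X.V, X.ρ⟩

lemma comm_apply {X Y : FDRep k G} (f : X ⟶ Y) (g : G) (x : X.V) :
    f.hom.hom.hom (X.ρ g x) = Y.ρ g (f.hom.hom.hom x) := by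
  have h := f.comm g
  have h2 := congrArg (fun t => t.hom.hom x) h
  exact h2

noncomputable def toHm {X Y : FDRep k G} (f : X ⟶ Y) : Hm (toRp X) (toRp Y) :=
  ⟨f.hom.hom.hom, fun g => LinearMap.ext fun x => comm_apply f g x⟩

noncomputable def ofHm {X Y : FDRep k G} (f : Hm (toRp X) (toRp Y)) : X ⟶ Y :=
  { hom := ⟨ModuleCat.ofHom f.toLinearMap⟩
    comm := fun g => by
      apply InducedCategory.hom_ext
      apply ModuleCat.hom_ext
      exact f.isIntertwining' g }

lemma toHm_apply {X Y : FDRep k G} (f : X ⟶ Y) (x : X.V) : toHm f x = f.hom.hom.hom x := rfl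

lemma fhom_ext {X Y : FDRep k G} {f g : X ⟶ Y} (h : ∀ x : X.V, toHm f x = toHm g x) : f = g := by
  apply Action.Hom.ext
  apply InducedCategory.hom_ext
  apply ModuleCat.hom_ext
  exact LinearMap.ext h

lemma toHm_ofHm {X Y : FDRep k G} (f : Hm (toRp X) (toRp Y)) (x : X.V) : toHm (ofHm f) x = f x := rfl

lemma toHm_comp {X Y Z : FDRep k G} (f : X ⟶ Y) (g : Y ⟶ Z) (x : X.V) :
    toHm (f ≫ g) x = toHm g (toHm f x) := rfl

lemma toHm_id {X : FDRep k G} (x : X.V) : toHm (𝟙 X) x = x := rfl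

lemma toHm_zero {X Y : FDRep k G} (x : X.V) : toHm (0 : X ⟶ Y) x = 0 := rfl

lemma toRp_tensor (X Y : FDRep k G) : toRp (X ⊗ Y) = (toRp X).tensor (toRp Y) := rfl

lemma toRp_tensorPow (M : FDRep k G) (s : ℕ) : toRp (tensorPow M s) = pw (toRp M) s := by
  induction s with
  | zero => rfl
  | succ s ih =>
    show toRp (tensorPow M s ⊗ M) = (pw (toRp M) s).tensor (toRp M)
    rw [toRp_tensor, ih]

lemma nontriv_of_not_isZero {X : FDRep k G} (h : ¬ Limits.IsZero X) : Nontrivial X.V := by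
  by_contra hh
  rw [not_nontrivial_iff_subsingleton] at hh
  apply h
  rw [Limits.IsZero.iff_id_eq_zero]
  exact fhom_ext fun x => Subsingleton.elim _ _

lemma ind_toRp {N : FDRep k G} (h : AlgebraicModule.Indecomposable N) : Ind (toRp N) := by
  refine ⟨nontriv_of_not_isZero h.1, fun e he => ?_⟩
  have h1 : ofHm e ≫ ofHm e = ofHm e := fhom_ext fun x => by
    rw [toHm_comp]
    exact DFunLike.congr_fun he x
  rcases h.2 _ h1 with h2 | h2
  · left
    refine DFunLike.ext _ _ fun x => ?_
    have := DFunLike.congr_fun (congrArg toHm h2) x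
    exact this
  · right
    refine DFunLike.ext _ _ fun x => ?_
    have := DFunLike.congr_fun (congrArg toHm h2) x
    exact this

lemma retr_toRp {N M : FDRep k G} (h : IsSummand N M) : Retr (toRp N) (toRp M) := by
  obtain ⟨i, r, h⟩ := h
  exact ⟨toHm i, toHm r, fun v => DFunLike.congr_fun (congrArg toHm h) v⟩

lemma iso_of_equiv {N : FDRep k G} {N' : Rp k G} (e : (toRp N).ρ.Equiv N'.ρ) :
    Nonempty (N ≅ FDRep.of N'.ρ) := by
  refine ⟨⟨ofHm (Y := FDRep.of N'.ρ) e.toIntertwiningMap,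
    ofHm (X := FDRep.of N'.ρ) e.symm.toIntertwiningMap, ?_, ?_⟩⟩
  · exact fhom_ext fun x => e.toEquiv.symm_apply_apply x
  · exact fhom_ext fun x => e.toEquiv.apply_symm_apply x

lemma irr_toRp {M : FDRep k G} (h : Simple M) : Irr (toRp M) := by
  refine ⟨nontriv_of_not_isZero (Simple.not_isZero M), fun W hW => ?_⟩
  let σ : Representation k G W :=
    { toFun := fun g => (M.ρ g).restrict (hW g)
      map_one' := by
        refine LinearMap.ext fun x => Subtype.ext ?_
        show M.ρ 1 x = x
        rw [map_one]; rfl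
      map_mul' := fun a b => by
        refine LinearMap.ext fun x => Subtype.ext ?_
        show M.ρ (a * b) x = M.ρ a (M.ρ b x)
        rw [map_mul]; rfl }
  let ι : FDRep.of σ ⟶ M := ofHm (X := FDRep.of σ) ⟨W.subtype, fun g => LinearMap.ext fun x => rfl⟩
  have hι : ∀ x : W, toHm ι x = (x : M.V) := fun x => rfl
  haveI : Mono ι := ⟨fun {Z} a b hab => fhom_ext fun z => by
    have := DFunLike.congr_fun (congrArg toHm hab) z
    exact Subtype.ext this⟩
  by_cases h0 : ι = 0
  · left
    rw [eq_bot_iff]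
    intro x hx
    have := DFunLike.congr_fun (congrArg toHm h0) (⟨x, hx⟩ : W)
    exact this
  · right
    haveI := (Simple.mono_isIso_iff_nonzero ι).2 h0
    rw [eq_top_iff]
    intro x _
    have := DFunLike.congr_fun (congrArg toHm (IsIso.inv_hom_id ι)) x
    have h3 : toHm ι (toHm (inv ι) x) = x := this
    rw [← h3]
    exact (toHm (inv ι) x : W).2

end bridge

open Polynomial in
theorem field_setup (p n : ℕ) [Fact p.Prime] (hn : n ≠ 0) (k : Type) [Field k] [CharP k p] :
    ∃ (K : Type) (_ : Field K) (_ : Algebra k K), FiniteDimensional k K ∧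
      Algebra.FormallyUnramified k K ∧ CharP K p ∧ Nonempty (GaloisField p n →+* K) := by
  let f : k[X] := X ^ p ^ n - X
  have hsep : f.Separable := galois_poly_separable p (p ^ n) (dvd_pow_self p hn)
  haveI : CharP f.SplittingField p := charP_of_injective_algebraMap (algebraMap k f.SplittingField).injective p
  haveI : Algebra.IsSeparable k f.SplittingField :=
    Algebra.isSeparable_of_separable_splitting_field k f.SplittingField hsep
  letI : Algebra (ZMod p) f.SplittingField := ZMod.algebra _ p
  refine ⟨f.SplittingField, inferInstance, inferInstance, inferInstance,
    Algebra.FormallyUnramified.of_isSeparable k _, inferInstance, ⟨?_⟩⟩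
  have hs : Splits ((X ^ p ^ n - X : (ZMod p)[X]).map (algebraMap (ZMod p) f.SplittingField)) := by
    have := SplittingField.splits f
    simpa [f] using this
  exact (SplittingField.lift (X ^ p ^ n - X : (ZMod p)[X]) hs).toRingHom

theorem final (p n : ℕ) [Fact p.Prime] (hn : 1 ≤ n)
    (k : Type) [Field k] (hk : CharP k p)
    (M : FDRep k (Matrix.SpecialLinearGroup (Fin 2) (GaloisField p n)))
    (hM : Simple M) : IsAlgebraic M := by
  obtain ⟨K, _, _, hfd, hun, hch, ⟨θ⟩⟩ := field_setup p n (by omega) k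
  have hp2 := (Fact.out : p.Prime).two_le
  obtain ⟨c, rfl⟩ : ∃ c, p = c + 2 := ⟨p - 2, by omega⟩
  haveI : NeZero n := ⟨by omega⟩
  obtain ⟨L, hL⟩ := main_list c n θ (GaloisField.card (c + 2) n (by omega)) (toRp M) (irr_toRp hM)
  refine ⟨L.map fun N => FDRep.of N.ρ, fun N hN hs => ?_⟩
  obtain ⟨s, hs⟩ := hs
  obtain ⟨N', hN', ⟨e⟩⟩ := hL (toRp N) (ind_toRp hN)
    ⟨s, by rw [← toRp_tensorPow]; exact retr_toRp hs⟩
  exact ⟨_, List.mem_map.2 ⟨N', hN', rfl⟩, iso_of_equiv e⟩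

end SLAlg

/-- Every simple `kG`-module for `G = SL_2(p^n)`, `k` a field of characteristic `p`,
is algebraic. -/
theorem simple_SL2_algebraic (p n : ℕ) [Fact p.Prime] (hn : 1 ≤ n)
    (k : Type) [Field k] (hk : CharP k p)
    (M : FDRep k (Matrix.SpecialLinearGroup (Fin 2) (GaloisField p n)))
    (hM : Simple M) : IsAlgebraic M := by
  exact SLAlg.final p n hn k hk M hM
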